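/- arXiv:1311.1411 — 2 statements merged into one kernel-verified Lean document; each statement's English description precedes it below -/
import Mathlib

section
/- (Single-letterization, equations (32)–(34).) Let the channel be memoryless: P(yⁿ,zⁿ|xⁿ) = Π_{i=1}^n Q_{YZ|X}(y_i,z_i|x_i) for a fixed channel Q_{YZ|X} on finite alphabets 𝒳, 𝒴, 𝒵, with Xⁿ a function of (M,W) where W is independent of M. Then (1/n)[ I(M;Yⁿ) − I(M;Zⁿ) ] ≤ max_{Q_{VX}} [ I(V;Y) − I(V;Z) ], where the maximum is over all joint distributions Q_{VX} of a pair (V,X) (V on a finite alphabet of cardinality at most |𝒳|) such that the single-letter variables satisfy the Markov chain V − X − (Y,Z), i.e., (V,X,Y,Z) has distribution Q_{VX}(v,x)·Q_{YZ|X}(y,z|x). -/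
open Finset

/-- Informational divergence (in bits) between two distributions on a finite set,
with the convention `0 * logb 2 (0/q) = 0` so the sum effectively runs over `supp P`. -/
noncomputable def KL {α : Type*} [Fintype α] (P Q : α → ℝ) : ℝ :=
  ∑ x, P x * Real.logb 2 (P x / Q x)

/-- `P` is a probability distribution on a finite set. -/
def IsDist {α : Type*} [Fintype α] (P : α → ℝ) : Prop :=
  (∀ x, 0 ≤ P x) ∧ ∑ x, P x = 1

/-- Distribution (pushforward) of the random variable `X` on the finite probability
space `(Ω, p)`. -/
noncomputable def distOf {Ω S : Type*} [Fintype Ω] [DecidableEq S]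
    (p : Ω → ℝ) (X : Ω → S) : S → ℝ :=
  fun s => ∑ ω, if X ω = s then p ω else 0

/-- Mutual information `I(X;Y) = D(P_{XY} || P_X × P_Y)` of two random variables on a
finite probability space `(Ω, p)`. -/
noncomputable def miRV {Ω S T : Type*} [Fintype Ω] [Fintype S] [Fintype T]
    [DecidableEq S] [DecidableEq T] (p : Ω → ℝ) (X : Ω → S) (Y : Ω → T) : ℝ :=
  KL (distOf p (fun ω => (X ω, Y ω))) (fun st => distOf p X st.1 * distOf p Y st.2)

/-- The conditional probability mass function on `Ω` given `Z = u`. -/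
noncomputable def condPMF {Ω U : Type*} [Fintype Ω] [DecidableEq U]
    (p : Ω → ℝ) (Z : Ω → U) (u : U) : Ω → ℝ :=
  fun ω => if Z ω = u then p ω / distOf p Z u else 0

/-- Conditional mutual information `I(X;Y|Z) = Σ_u P_Z(u) · I(X;Y | Z = u)`. -/
noncomputable def cmiRV {Ω S T U : Type*} [Fintype Ω] [Fintype S] [Fintype T] [Fintype U]
    [DecidableEq S] [DecidableEq T] [DecidableEq U]
    (p : Ω → ℝ) (X : Ω → S) (Y : Ω → T) (Z : Ω → U) : ℝ :=
  ∑ u, distOf p Z u * miRV (condPMF p Z u) X Y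


/-- Output-entropy functional (in nats) of a nonnegative vector through a kernel. -/
noncomputable def hc {X A : Type*} [Fintype X] [Fintype A] (K : X → A → ℝ) (r : X → ℝ) : ℝ :=
  ∑ a, Real.negMulLog (∑ x, r x * K x a)

theorem hc_smul {X A : Type*} [Fintype X] [Fintype A] (K : X → A → ℝ)
    (hK : ∀ x, ∑ a, K x a = 1) (c : ℝ) (r : X → ℝ) :
    hc K (fun x => c * r x) = c * hc K r + (∑ x, r x) * Real.negMulLog c := by
  unfold hc
  have h1 : ∀ a, ∑ x, c * r x * K x a = c * ∑ x, r x * K x a := by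
    intro a; rw [Finset.mul_sum]; exact Finset.sum_congr rfl fun x _ => by ring
  have h2 : ∑ a, ∑ x, r x * K x a = ∑ x, r x := by
    rw [Finset.sum_comm]
    exact Finset.sum_congr rfl fun x _ => by rw [← Finset.mul_sum, hK, mul_one]
  simp_rw [h1, Real.negMulLog_mul]
  rw [Finset.sum_add_distrib, ← Finset.sum_mul, h2, ← Finset.mul_sum]
  ring

/-- Difference functional. -/
noncomputable def gd {X A B : Type*} [Fintype X] [Fintype A] [Fintype B]
    (K : X → A → ℝ) (L : X → B → ℝ) (r : X → ℝ) : ℝ := hc K r - hc L r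

theorem gd_smul {X A B : Type*} [Fintype X] [Fintype A] [Fintype B]
    (K : X → A → ℝ) (L : X → B → ℝ)
    (hK : ∀ x, ∑ a, K x a = 1) (hL : ∀ x, ∑ a, L x a = 1) (c : ℝ) (r : X → ℝ) :
    gd K L (fun x => c * r x) = c * gd K L r := by
  unfold gd; rw [hc_smul K hK, hc_smul L hL]; ring

theorem hc_bound {X A : Type*} [Fintype X] [Fintype A] (K : X → A → ℝ)
    (hK0 : ∀ x a, 0 ≤ K x a) (hK : ∀ x, ∑ a, K x a = 1) (r : X → ℝ)
    (hr : ∀ x, 0 ≤ r x) (hr1 : ∑ x, r x = 1) : 0 ≤ hc K r ∧ hc K r ≤ Fintype.card A := by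
  have h0 : ∀ a, 0 ≤ ∑ x, r x * K x a := fun a =>
    Finset.sum_nonneg fun x _ => mul_nonneg (hr x) (hK0 x a)
  have h1 : ∀ a, ∑ x, r x * K x a ≤ 1 := fun a => by
    rw [← hr1]
    refine Finset.sum_le_sum fun x _ => mul_le_of_le_one_right (hr x) ?_
    rw [← hK x]
    exact Finset.single_le_sum (f := fun a => K x a) (fun a _ => hK0 x a) (Finset.mem_univ a)
  constructor
  · exact Finset.sum_nonneg fun a _ => Real.negMulLog_nonneg (h0 a) (h1 a)
  · have : hc K r ≤ ∑ a : A, (1:ℝ) := by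
      refine Finset.sum_le_sum fun a _ => ?_
      rcases (h0 a).eq_or_lt with h | h
      · rw [← h]; simp
      · have := Real.one_sub_inv_le_log_of_pos h
        unfold Real.negMulLog
        have h3 := mul_le_mul_of_nonneg_left this h.le
        rw [mul_sub, mul_inv_cancel₀ h.ne'] at h3
        linarith
    simpa using this

theorem gd_bound {X A B : Type*} [Fintype X] [Fintype A] [Fintype B]
    (K : X → A → ℝ) (L : X → B → ℝ)
    (hK0 : ∀ x a, 0 ≤ K x a) (hL0 : ∀ x a, 0 ≤ L x a)
    (hK : ∀ x, ∑ a, K x a = 1) (hL : ∀ x, ∑ a, L x a = 1) (r : X → ℝ) (hr : ∀ x, 0 ≤ r x) :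
    |gd K L r| ≤ (Fintype.card A + Fintype.card B) * ∑ x, r x := by
  have hs : 0 ≤ ∑ x, r x := Finset.sum_nonneg fun x _ => hr x
  rcases hs.eq_or_lt with h | h
  · have h0 : r = fun x => 0 * r x := by
      funext x
      have := (Finset.sum_eq_zero_iff_of_nonneg (fun x _ => hr x)).1 h.symm x (Finset.mem_univ x)
      rw [this]; ring
    rw [h0, gd_smul K L hK hL]; simp
  · have e : r = fun x => (∑ x, r x) * (r x / ∑ x, r x) := by
      funext x; field_simp
    have hg : gd K L r = (∑ x, r x) * gd K L (fun x => r x / ∑ x, r x) := by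
      conv_lhs => rw [e]
      rw [gd_smul K L hK hL]
    have hr1 : ∑ x, (r x / ∑ x, r x) = 1 := by rw [← Finset.sum_div]; exact div_self h.ne'
    have b1 := hc_bound K hK0 hK _ (fun x => div_nonneg (hr x) hs) hr1
    have b2 := hc_bound L hL0 hL _ (fun x => div_nonneg (hr x) hs) hr1
    rw [hg, abs_mul, abs_of_pos h, mul_comm]
    refine mul_le_mul_of_nonneg_right ?_ hs
    unfold gd
    rw [abs_le]; constructor <;> linarith [b1.1, b1.2, b2.1, b2.2]

/-- Cardinality reduction. -/
theorem card_reduce {X ι : Type*} [Fintype X] (G : (X → ℝ) → ℝ)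
    (hG : ∀ (c : ℝ) (r : X → ℝ), G (fun x => c * r x) = c * G r) :
    ∀ (N : ℕ) (s : Finset ι), s.card ≤ N → ∀ (r : ι → X → ℝ), (∀ m x, 0 ≤ r m x) →
      ∃ k : ℕ, k ≤ Fintype.card X ∧ ∃ r' : Fin k → X → ℝ, (∀ v x, 0 ≤ r' v x) ∧
        (∀ x, ∑ v, r' v x = ∑ m ∈ s, r m x) ∧ ∑ v, G (r' v) ≤ ∑ m ∈ s, G (r m) := by
  classical
  have hG0 : ∀ r : X → ℝ, (∀ x, r x = 0) → G r = 0 := by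
    intro r h
    have : r = fun x => 0 * r x := by funext x; rw [h x]; ring
    rw [this, hG]; ring
  intro N
  induction N with
  | zero =>
    intro s hs r hr
    have : s = ∅ := by simpa using hs
    subst this
    exact ⟨0, Nat.zero_le _, fun _ _ => 0, by simp, by simp, by simp⟩
  | succ N ih =>
    intro s hs r hr
    -- removing a zero vector
    have key : ∀ (r : ι → X → ℝ), (∀ m x, 0 ≤ r m x) → (∃ m ∈ s, ∀ x, r m x = 0) →
        ∃ k : ℕ, k ≤ Fintype.card X ∧ ∃ r' : Fin k → X → ℝ, (∀ v x, 0 ≤ r' v x) ∧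
        (∀ x, ∑ v, r' v x = ∑ m ∈ s, r m x) ∧ ∑ v, G (r' v) ≤ ∑ m ∈ s, G (r m) := by
      intro r hr ⟨m, hm, h0⟩
      obtain ⟨k, hk, r', h1, h2, h3⟩ := ih (s.erase m)
        (by rw [Finset.card_erase_of_mem hm]; omega) r hr
      refine ⟨k, hk, r', h1, ?_, ?_⟩
      · intro x; rw [h2 x, ← Finset.add_sum_erase s _ hm, h0 x, zero_add]
      · rw [← Finset.add_sum_erase s _ hm, hG0 _ h0, zero_add]; exact h3
    by_cases hc : s.card ≤ Fintype.card X
    · refine ⟨s.card, hc, fun v => r (s.equivFin.symm v), fun v x => hr _ x, ?_, ?_⟩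
      · intro x
        rw [← Finset.sum_coe_sort s (fun m => r m x)]
        exact Fintype.sum_equiv s.equivFin.symm _ _ (fun _ => rfl)
      · rw [← Finset.sum_coe_sort s (fun m => G (r m))]
        exact (Fintype.sum_equiv s.equivFin.symm (fun v => G (r (s.equivFin.symm v)))
          (fun m : s => G (r m)) (fun _ => rfl)).le
    by_cases hz : ∃ m ∈ s, ∀ x, r m x = 0
    · exact key r hr hz
    push Not at hz
    have hli : ¬ LinearIndependent ℝ (fun m : s => r m) := by
      intro h
      have := h.fintype_card_le_finrank
      simp at this
      omega
    rw [Fintype.not_linearIndependent_iff] at hli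
    obtain ⟨g, hg, m0, hm0⟩ := hli
    -- extend to ι with a sign choice
    obtain ⟨μ, hμ0, hμ1, hμG⟩ : ∃ μ : ι → ℝ, (∃ m ∈ s, μ m ≠ 0) ∧
        (∀ x, ∑ m ∈ s, μ m * r m x = 0) ∧ ∑ m ∈ s, μ m * G (r m) ≤ 0 := by
      have hx : ∀ x, ∑ m ∈ s, (if h : m ∈ s then g ⟨m, h⟩ else 0) * r m x = 0 := by
        intro x
        have := congrFun hg x
        rw [← Finset.sum_coe_sort s]
        simpa [Finset.sum_apply] using this
      rcases le_total (∑ m ∈ s, (if h : m ∈ s then g ⟨m, h⟩ else 0) * G (r m)) 0 with h | h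
      · exact ⟨fun m => if h : m ∈ s then g ⟨m, h⟩ else 0, ⟨m0, m0.2, by simpa using hm0⟩, hx, h⟩
      · refine ⟨fun m => - (if h : m ∈ s then g ⟨m, h⟩ else 0),
          ⟨m0, m0.2, by simpa using hm0⟩, ?_, ?_⟩
        · intro x; simp only [neg_mul, Finset.sum_neg_distrib, hx x, neg_zero]
        · simp only [neg_mul, Finset.sum_neg_distrib]; linarith
    have hneg : (s.filter (fun m => μ m < 0)).Nonempty := by
      by_contra hne
      rw [Finset.not_nonempty_iff_eq_empty, Finset.filter_eq_empty_iff] at hne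
      obtain ⟨m, hm, hmne⟩ := hμ0
      obtain ⟨x, hx⟩ := hz m hm
      have h1 := (Finset.sum_eq_zero_iff_of_nonneg
        (fun j hj => mul_nonneg (not_lt.1 (hne hj)) (hr j x))).1 (hμ1 x) m hm
      rcases mul_eq_zero.1 h1 with h | h
      · exact hmne h
      · exact hx h
    obtain ⟨m1, hm1, hmin⟩ := Finset.exists_min_image _ μ hneg
    rw [Finset.mem_filter] at hm1
    obtain ⟨hm1s, hm1n⟩ := hm1
    have hall : ∀ m ∈ s, μ m1 ≤ μ m := by
      intro m hm
      rcases lt_or_ge (μ m) 0 with h | h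
      · exact hmin m (Finset.mem_filter.2 ⟨hm, h⟩)
      · linarith
    set t : ℝ := 1 / (- μ m1) with ht
    have htp : 0 < t := by rw [ht]; apply one_div_pos.2; linarith
    have htm : t * μ m1 = -1 := by rw [ht]; have := hm1n.ne; rw [one_div, inv_neg, neg_mul, inv_mul_cancel₀ this]
    have hcoef : ∀ m ∈ s, 0 ≤ 1 + t * μ m := by
      intro m hm
      have := mul_le_mul_of_nonneg_left (hall m hm) htp.le
      linarith
    obtain ⟨k, hk, r', h1, h2, h3⟩ := key
      (fun m x => (if m ∈ s then 1 + t * μ m else 0) * r m x) (by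
        intro m x
        refine mul_nonneg ?_ (hr m x)
        split_ifs with h
        · exact hcoef m h
        · exact le_rfl) ⟨m1, hm1s, fun x => by rw [if_pos hm1s, htm]; ring⟩
    refine ⟨k, hk, r', h1, ?_, ?_⟩
    · intro x
      rw [h2 x]
      have : ∑ m ∈ s, (if m ∈ s then 1 + t * μ m else 0) * r m x
          = ∑ m ∈ s, (r m x + t * (μ m * r m x)) :=
        Finset.sum_congr rfl fun m hm => by rw [if_pos hm]; ring
      rw [this, Finset.sum_add_distrib, ← Finset.mul_sum, hμ1 x]; ring
    · refine h3.trans ?_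
      have : ∑ m ∈ s, G (fun x => (if m ∈ s then 1 + t * μ m else 0) * r m x)
          = ∑ m ∈ s, (G (r m) + t * (μ m * G (r m))) :=
        Finset.sum_congr rfl fun m hm => by rw [hG, if_pos hm]; ring
      rw [this, Finset.sum_add_distrib, ← Finset.mul_sum]
      have := mul_nonpos_of_nonneg_of_nonpos htp.le hμG
      linarith

/-- mutual information as entropies -/
theorem miRV_eq {Ω S T : Type*} [Fintype Ω] [Fintype S] [Fintype T]
    [DecidableEq S] [DecidableEq T] (p : Ω → ℝ) (hp : ∀ ω, 0 ≤ p ω) (X : Ω → S) (Y : Ω → T) :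
    miRV p X Y = (∑ s, Real.negMulLog (distOf p X s) + ∑ t, Real.negMulLog (distOf p Y t)
      - ∑ s, ∑ t, Real.negMulLog (distOf p (fun ω => (X ω, Y ω)) (s, t))) / Real.log 2 := by
  have hX : ∀ s, distOf p X s = ∑ t, distOf p (fun ω => (X ω, Y ω)) (s, t) := by
    intro s
    unfold distOf
    rw [Finset.sum_comm]
    refine Finset.sum_congr rfl fun ω _ => ?_
    by_cases h : X ω = s <;> simp [h]
  have hY : ∀ t, distOf p Y t = ∑ s, distOf p (fun ω => (X ω, Y ω)) (s, t) := by
    intro t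
    unfold distOf
    rw [Finset.sum_comm]
    refine Finset.sum_congr rfl fun ω _ => ?_
    by_cases h : Y ω = t <;> simp [h]
  have h0 : ∀ st, 0 ≤ distOf p (fun ω => (X ω, Y ω)) st := by
    intro st
    unfold distOf
    exact Finset.sum_nonneg fun ω _ => by split_ifs <;> simp [hp]
  have e1 : ∑ s, Real.negMulLog (distOf p X s) =
      ∑ s, ∑ t, - (distOf p (fun ω => (X ω, Y ω)) (s, t) * Real.log (distOf p X s)) := by
    refine Finset.sum_congr rfl fun s _ => ?_
    rw [Finset.sum_neg_distrib, ← Finset.sum_mul, ← hX]; unfold Real.negMulLog; ring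
  have e2 : ∑ t, Real.negMulLog (distOf p Y t) =
      ∑ s, ∑ t, - (distOf p (fun ω => (X ω, Y ω)) (s, t) * Real.log (distOf p Y t)) := by
    rw [Finset.sum_comm]
    refine Finset.sum_congr rfl fun s _ => ?_
    rw [Finset.sum_neg_distrib, ← Finset.sum_mul, ← hY]; unfold Real.negMulLog; ring
  rw [e1, e2, ← Finset.sum_add_distrib, ← Finset.sum_sub_distrib, Finset.sum_div]
  unfold miRV KL
  rw [Fintype.sum_prod_type]
  refine Finset.sum_congr rfl fun s _ => ?_
  rw [← Finset.sum_add_distrib, ← Finset.sum_sub_distrib, Finset.sum_div]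
  refine Finset.sum_congr rfl fun t _ => ?_
  rcases (h0 (s, t)).eq_or_lt with h | h
  · rw [← h]; simp
  · have p1 : 0 < distOf p X s := by
      rw [hX]
      exact h.trans_le (Finset.single_le_sum
        (f := fun t => distOf p (fun ω => (X ω, Y ω)) (s, t)) (fun t _ => h0 _) (Finset.mem_univ t))
    have p2 : 0 < distOf p Y t := by
      rw [hY]
      exact h.trans_le (Finset.single_le_sum
        (f := fun s => distOf p (fun ω => (X ω, Y ω)) (s, t)) (fun t _ => h0 _) (Finset.mem_univ s))
    unfold Real.logb Real.negMulLog
    rw [Real.log_div h.ne' (mul_pos p1 p2).ne', Real.log_mul p1.ne' p2.ne']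
    ring

/-- Joint law of the message and the `n` outputs for channels `K i`. -/
noncomputable def jn {M W X A : Type*} [Fintype W] {n : ℕ} (PM : M → ℝ) (PW : W → ℝ)
    (f : M → W → Fin n → X) (K : Fin n → X → A → ℝ) (m : M) (t : Fin n → A) : ℝ :=
  ∑ w, PM m * PW w * ∏ i, K i (f m w i) (t i)

/-- `H(T) - H(M,T)`. -/
noncomputable def phi {M T : Type*} [Fintype M] [Fintype T] (J : M → T → ℝ) : ℝ :=
  ∑ t, Real.negMulLog (∑ m, J m t) - ∑ m, ∑ t, Real.negMulLog (J m t)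

open Classical in
/-- Joint law of the other outputs, the message, and the `i`-th input. -/
noncomputable def rr {M W X A : Type*} [Fintype W] {n : ℕ} (PM : M → ℝ) (PW : W → ℝ)
    (f : M → W → Fin (n + 1) → X) (K : Fin (n + 1) → X → A → ℝ) (i : Fin (n + 1))
    (u : Fin n → A) (m : M) (x : X) : ℝ :=
  ∑ w, if f m w i = x then
    PM m * PW w * ∏ j, K (i.succAbove j) (f m w (i.succAbove j)) (u j) else 0

theorem jn_insert {M W X A : Type*} [Fintype W] [Fintype X] {n : ℕ} (PM : M → ℝ) (PW : W → ℝ)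
    (f : M → W → Fin (n + 1) → X) (K : Fin (n + 1) → X → A → ℝ) (i : Fin (n + 1))
    (u : Fin n → A) (m : M) (a : A) :
    jn PM PW f K m (i.insertNth (α := fun _ => A) a u)
      = ∑ x, rr PM PW f K i u m x * K i x a := by
  classical
  unfold jn rr
  simp_rw [Finset.sum_mul]
  rw [Finset.sum_comm]
  refine Finset.sum_congr rfl fun w _ => ?_
  simp_rw [ite_mul, zero_mul]
  rw [Finset.sum_ite_eq]
  simp only [Finset.mem_univ, if_true]
  rw [Fin.prod_univ_succAbove _ i]
  simp only [Fin.insertNth_apply_same, Fin.insertNth_apply_succAbove]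
  ring

theorem sum_insert {A : Type*} [Fintype A] {n : ℕ} (i : Fin (n + 1))
    (F : (Fin (n + 1) → A) → ℝ) :
    ∑ t, F t = ∑ u : Fin n → A, ∑ a, F (i.insertNth (α := fun _ => A) a u) := by
  rw [← Equiv.sum_comp (Fin.insertNthEquiv (fun _ => A) i), Fintype.sum_prod_type,
    Finset.sum_comm]
  rfl

theorem phi_jn {M W X A : Type*} [Fintype M] [Fintype W] [Fintype X] [Fintype A] {n : ℕ}
    (PM : M → ℝ) (PW : W → ℝ)
    (f : M → W → Fin (n + 1) → X) (K : Fin (n + 1) → X → A → ℝ) (i : Fin (n + 1)) :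
    phi (jn PM PW f K) = ∑ u, (hc (K i) (fun x => ∑ m, rr PM PW f K i u m x)
      - ∑ m, hc (K i) (rr PM PW f K i u m)) := by
  unfold phi hc
  rw [Finset.sum_sub_distrib]
  congr 1
  · rw [sum_insert i]
    refine Finset.sum_congr rfl fun u _ => Finset.sum_congr rfl fun a _ => ?_
    congr 1
    simp_rw [jn_insert, Finset.sum_mul]
    rw [Finset.sum_comm]
  · rw [Finset.sum_comm]
    rw [sum_insert i, ]
    refine Finset.sum_congr rfl fun u _ => ?_
    rw [Finset.sum_comm]
    simp_rw [jn_insert]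

theorem rr_congr {M W X A : Type*} [Fintype W] {n : ℕ} (PM : M → ℝ) (PW : W → ℝ)
    (f : M → W → Fin (n + 1) → X) (K K' : Fin (n + 1) → X → A → ℝ) (i : Fin (n + 1))
    (h : ∀ j, j ≠ i → K j = K' j) : rr PM PW f K i = rr PM PW f K' i := by
  funext u m x
  unfold rr
  have : ∀ j, K (i.succAbove j) = K' (i.succAbove j) := fun j => h _ (Fin.succAbove_ne i j)
  simp_rw [this]

theorem rr_mass {M W X A : Type*} [Fintype M] [Fintype W] [Fintype X] [Fintype A] {n : ℕ}
    (PM : M → ℝ) (hPM : ∑ m, PM m = 1) (PW : W → ℝ) (hPW : ∑ w, PW w = 1)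
    (f : M → W → Fin (n + 1) → X) (K : Fin (n + 1) → X → A → ℝ)
    (hK : ∀ j x, ∑ a, K j x a = 1) (i : Fin (n + 1)) :
    ∑ u, ∑ m, ∑ x, rr PM PW f K i u m x = 1 := by
  classical
  unfold rr
  have h1 : ∀ (u : Fin n → A) m, ∑ x, ∑ w, (if f m w i = x then
      PM m * PW w * ∏ j, K (i.succAbove j) (f m w (i.succAbove j)) (u j) else 0)
      = ∑ w, PM m * PW w * ∏ j, K (i.succAbove j) (f m w (i.succAbove j)) (u j) := by
    intro u m
    rw [Finset.sum_comm]
    refine Finset.sum_congr rfl fun w _ => ?_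
    rw [Finset.sum_ite_eq]; simp
  have h2 : ∀ m w, ∑ u : Fin n → A, ∏ j, K (i.succAbove j) (f m w (i.succAbove j)) (u j) = 1 := by
    intro m w
    have := Finset.prod_univ_sum (fun _ : Fin n => (Finset.univ : Finset A))
      (fun j a => K (i.succAbove j) (f m w (i.succAbove j)) a)
    rw [Fintype.piFinset_univ] at this
    rw [← this]
    simp [hK]
  calc _ = ∑ u : Fin n → A, ∑ m, ∑ w,
        PM m * PW w * ∏ j, K (i.succAbove j) (f m w (i.succAbove j)) (u j) :=
        Finset.sum_congr rfl fun u _ => Finset.sum_congr rfl fun m _ => by convert h1 u m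
    _ = ∑ m, ∑ w, PM m * PW w := by
        rw [Finset.sum_comm]
        refine Finset.sum_congr rfl fun m _ => ?_
        rw [Finset.sum_comm]
        refine Finset.sum_congr rfl fun w _ => ?_
        rw [← Finset.mul_sum, h2, mul_one]
    _ = 1 := by simp_rw [← Finset.mul_sum, hPW, mul_one, hPM]

theorem rr_nonneg {M W X A : Type*} [Fintype W] {n : ℕ}
    (PM : M → ℝ) (hPM : ∀ m, 0 ≤ PM m) (PW : W → ℝ) (hPW : ∀ w, 0 ≤ PW w)
    (f : M → W → Fin (n + 1) → X) (K : Fin (n + 1) → X → A → ℝ)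
    (hK : ∀ j x a, 0 ≤ K j x a) (i : Fin (n + 1)) (u : Fin n → A) (m : M) (x : X) :
    0 ≤ rr PM PW f K i u m x := by
  unfold rr
  refine Finset.sum_nonneg fun w _ => ?_
  split_ifs
  · exact mul_nonneg (mul_nonneg (hPM m) (hPW w)) (Finset.prod_nonneg fun j _ => hK _ _ _)
  · exact le_rfl

theorem phi_step {M W X A : Type*} [Fintype M] [Fintype W] [Fintype X] [Fintype A] {n : ℕ}
    (PM : M → ℝ) (hPM : IsDist PM) (PW : W → ℝ) (hPW : IsDist PW)
    (f : M → W → Fin n → X) (K K' : Fin n → X → A → ℝ)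
    (hK0 : ∀ j x a, 0 ≤ K j x a) (hK : ∀ j x, ∑ a, K j x a = 1) (i : Fin n)
    (h : ∀ j, j ≠ i → K j = K' j) (S : ℝ)
    (hS : ∀ r : M → X → ℝ, (∀ m x, 0 ≤ r m x) →
      gd (K i) (K' i) (fun x => ∑ m, r m x) - ∑ m, gd (K i) (K' i) (r m)
        ≤ S * ∑ m, ∑ x, r m x) :
    phi (jn PM PW f K) - phi (jn PM PW f K') ≤ S := by
  cases n with
  | zero => exact i.elim0
  | succ n =>
    rw [phi_jn PM PW f K i, phi_jn PM PW f K' i, ← rr_congr PM PW f K K' i h,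
      ← Finset.sum_sub_distrib]
    calc _ ≤ ∑ u, S * ∑ m, ∑ x, rr PM PW f K i u m x := by
          refine Finset.sum_le_sum fun u _ => ?_
          refine le_trans (le_of_eq ?_)
            (hS (rr PM PW f K i u) (rr_nonneg PM hPM.1 PW hPW.1 f K hK0 i u))
          unfold gd
          rw [Finset.sum_sub_distrib]; ring
      _ = S := by rw [← Finset.mul_sum, rr_mass PM hPM.2 PW hPW.2 f K hK i, mul_one]

theorem phi_tele {M W X A : Type*} [Fintype M] [Fintype W] [Fintype X] [Fintype A] {n : ℕ}
    (PM : M → ℝ) (hPM : IsDist PM) (PW : W → ℝ) (hPW : IsDist PW)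
    (f : M → W → Fin n → X) (K L : X → A → ℝ)
    (hK0 : ∀ x a, 0 ≤ K x a) (hK : ∀ x, ∑ a, K x a = 1)
    (hL0 : ∀ x a, 0 ≤ L x a) (hL : ∀ x, ∑ a, L x a = 1) (S : ℝ)
    (hS : ∀ r : M → X → ℝ, (∀ m x, 0 ≤ r m x) →
      gd K L (fun x => ∑ m, r m x) - ∑ m, gd K L (r m) ≤ S * ∑ m, ∑ x, r m x) :
    phi (jn PM PW f (fun _ => K)) - phi (jn PM PW f (fun _ => L)) ≤ n * S := by
  have key : ∀ j : ℕ, j ≤ n →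
      phi (jn PM PW f (fun i => if (i : ℕ) < j then K else L))
        - phi (jn PM PW f (fun _ => L)) ≤ j * S := by
    intro j
    induction j with
    | zero => intro _; simp
    | succ j ih =>
      intro hj
      have h1 := ih (by omega)
      have h2 := phi_step PM hPM PW hPW f (fun i => if (i : ℕ) < j + 1 then K else L)
        (fun i => if (i : ℕ) < j then K else L)
        (by intro i x a; split_ifs; exacts [hK0 x a, hL0 x a])
        (by intro i x; split_ifs; exacts [hK x, hL x]) ⟨j, by omega⟩
        (by
          intro i hi
          have hi' : (i : ℕ) ≠ j := fun h => hi (Fin.ext h)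

          have : ((i : ℕ) < j + 1) ↔ ((i : ℕ) < j) := by omega
          simp only [this]) S
        (by simpa using hS)
      push_cast
      linarith
  have := key n le_rfl
  simpa using this

theorem sum_ext_inj {S T : Type*} [Fintype S] [Fintype T] (e : S → T)
    (he : Function.Injective e) (F : T → ℝ) (h : ∀ t, t ∉ Set.range e → F t = 0) :
    ∑ t, F t = ∑ s, F (e s) := by
  symm
  refine Finset.sum_of_injOn e he.injOn (by simp) ?_ (fun _ _ => rfl)
  intro t _ ht
  exact h t (by simpa using ht)

theorem hc_ext {X A B : Type*} [Fintype X] [Fintype A] [Fintype B] (e : B → A)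
    (he : Function.Injective e) (K : X → A → ℝ) (h0 : ∀ x a, a ∉ Set.range e → K x a = 0)
    (r : X → ℝ) : hc K r = hc (fun x b => K x (e b)) r := by
  unfold hc
  refine sum_ext_inj e he _ fun a ha => ?_
  simp [h0 _ a ha]

theorem phi_ext {M W X A B : Type*} [Fintype M] [Fintype W] [Fintype A] [Fintype B]
    {n : ℕ} (PM : M → ℝ) (PW : W → ℝ) (f : M → W → Fin n → X) (e : B → A)
    (he : Function.Injective e) (K : X → A → ℝ) (h0 : ∀ x a, a ∉ Set.range e → K x a = 0) :
    phi (jn PM PW f (fun _ => K)) = phi (jn PM PW f (fun _ x b => K x (e b))) := by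
  have hj : ∀ m (t : Fin n → A), t ∉ Set.range (fun s : Fin n → B => e ∘ s) →
      jn PM PW f (fun _ => K) m t = 0 := by
    intro m t ht
    have : ∃ i, t i ∉ Set.range e := by
      by_contra hcon
      push Not at hcon
      choose s hs using hcon
      exact ht ⟨s, funext hs⟩
    obtain ⟨i, hi⟩ := this
    unfold jn
    refine Finset.sum_eq_zero fun w _ => ?_
    rw [Finset.prod_eq_zero (Finset.mem_univ i) (h0 _ _ hi), mul_zero]
  have hinj : Function.Injective (fun s : Fin n → B => e ∘ s) := he.comp_left
  unfold phi
  congr 1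
  · rw [sum_ext_inj _ hinj]
    · rfl
    · intro t ht
      simp [hj _ t ht]
  · refine Finset.sum_congr rfl fun m _ => ?_
    rw [sum_ext_inj _ hinj]
    · rfl
    · intro t ht
      simp [hj _ t ht]

/-- generic: mutual information through the joint law -/
theorem miRV_phi {Ω S T : Type*} [Fintype Ω] [Fintype S] [Fintype T]
    [DecidableEq S] [DecidableEq T] (p : Ω → ℝ) (hp : ∀ ω, 0 ≤ p ω) (X : Ω → S) (Y : Ω → T)
    (J : S → T → ℝ) (hJ : ∀ s t, distOf p (fun ω => (X ω, Y ω)) (s, t) = J s t) :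
    miRV p X Y = (∑ s, Real.negMulLog (distOf p X s) + phi J) / Real.log 2 := by
  have hY : ∀ t, distOf p Y t = ∑ s, J s t := by
    intro t
    simp_rw [← hJ]
    unfold distOf
    rw [Finset.sum_comm]
    refine Finset.sum_congr rfl fun ω _ => ?_
    by_cases h : Y ω = t <;> simp [h]
  rw [miRV_eq p hp]
  unfold phi
  simp_rw [hY, hJ]
  ring

theorem distOf_single_Y {k : ℕ} {X Y Z : Type*} [Fintype X] [Fintype Y] [Fintype Z]
    [DecidableEq Y] (q : Fin k × X → ℝ) (Q : X → Y × Z → ℝ) (v : Fin k) (y : Y) :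
    distOf (fun ω : Fin k × X × Y × Z => q (ω.1, ω.2.1) * Q ω.2.1 (ω.2.2.1, ω.2.2.2))
      (fun ω => (ω.1, ω.2.2.1)) (v, y) = ∑ x, q (v, x) * ∑ z, Q x (y, z) := by
  unfold distOf
  simp only [Fintype.sum_prod_type, Prod.mk.injEq, ite_and]
  rw [Finset.sum_eq_single v (fun b _ hb => by simp [hb]) (by simp)]
  refine Finset.sum_congr rfl fun x _ => ?_
  rw [Finset.sum_eq_single y (fun b _ hb => by simp [hb]) (by simp)]
  simp [Finset.mul_sum]

theorem distOf_single_Z {k : ℕ} {X Y Z : Type*} [Fintype X] [Fintype Y] [Fintype Z]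
    [DecidableEq Z] (q : Fin k × X → ℝ) (Q : X → Y × Z → ℝ) (v : Fin k) (z : Z) :
    distOf (fun ω : Fin k × X × Y × Z => q (ω.1, ω.2.1) * Q ω.2.1 (ω.2.2.1, ω.2.2.2))
      (fun ω => (ω.1, ω.2.2.2)) (v, z) = ∑ x, q (v, x) * ∑ y, Q x (y, z) := by
  unfold distOf
  simp only [Fintype.sum_prod_type, Prod.mk.injEq, ite_and]
  rw [Finset.sum_eq_single v (fun b _ hb => by simp [hb]) (by simp)]
  refine Finset.sum_congr rfl fun x _ => ?_
  simp [Finset.mul_sum]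

theorem phi_single {k : ℕ} {X A : Type*} [Fintype X] [Fintype A]
    (q : Fin k × X → ℝ) (K : X → A → ℝ) :
    phi (fun v a => ∑ x, q (v, x) * K x a)
      = hc K (fun x => ∑ v, q (v, x)) - ∑ v, hc K (fun x => q (v, x)) := by
  unfold phi hc
  congr 1
  refine Finset.sum_congr rfl fun a _ => ?_
  rw [Finset.sum_comm]
  simp_rw [Finset.sum_mul]

theorem single_val {k : ℕ} {X Y Z : Type*} [Fintype X] [Fintype Y] [Fintype Z]
    [DecidableEq Y] [DecidableEq Z] (q : Fin k × X → ℝ) (hq : ∀ a, 0 ≤ q a)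
    (Q : X → Y × Z → ℝ) (hQ : ∀ x a, 0 ≤ Q x a) :
    miRV (fun ω : Fin k × X × Y × Z => q (ω.1, ω.2.1) * Q ω.2.1 (ω.2.2.1, ω.2.2.2))
        (fun ω => ω.1) (fun ω => ω.2.2.1)
      - miRV (fun ω : Fin k × X × Y × Z => q (ω.1, ω.2.1) * Q ω.2.1 (ω.2.2.1, ω.2.2.2))
        (fun ω => ω.1) (fun ω => ω.2.2.2)
    = (gd (fun x y => ∑ z, Q x (y, z)) (fun x z => ∑ y, Q x (y, z)) (fun x => ∑ v, q (v, x))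
      - ∑ v, gd (fun x y => ∑ z, Q x (y, z)) (fun x z => ∑ y, Q x (y, z)) (fun x => q (v, x)))
        / Real.log 2 := by
  have h0 : ∀ ω : Fin k × X × Y × Z, 0 ≤ q (ω.1, ω.2.1) * Q ω.2.1 (ω.2.2.1, ω.2.2.2) :=
    fun ω => mul_nonneg (hq _) (hQ _ _)
  rw [miRV_phi _ h0 _ _ _ (distOf_single_Y q Q), miRV_phi _ h0 _ _ _ (distOf_single_Z q Q),
    phi_single q (fun x y => ∑ z, Q x (y, z)), phi_single q (fun x z => ∑ y, Q x (y, z))]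
  unfold gd
  rw [Finset.sum_sub_distrib]
  ring

theorem sum_prod_pi {Z : Type*} [Fintype Z] {n : ℕ} (F : Fin n → Z → ℝ) :
    ∑ z : Fin n → Z, ∏ i, F i (z i) = ∏ i, ∑ z, F i z := by
  have := Finset.prod_univ_sum (fun _ : Fin n => (Finset.univ : Finset Z)) F
  rw [Fintype.piFinset_univ] at this
  exact this.symm

theorem distOf_multi_Y {M W X Y Z : Type*} [Fintype M] [Fintype W] [Fintype Y] [Fintype Z]
    [DecidableEq M] [DecidableEq Y] {n : ℕ} (Q : X → Y × Z → ℝ) (PM : M → ℝ) (PW : W → ℝ)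
    (f : M → W → Fin n → X) (p : M × W × (Fin n → Y) × (Fin n → Z) → ℝ)
    (hp : ∀ m w y z, p (m, w, y, z) = PM m * PW w * ∏ i, Q (f m w i) (y i, z i))
    (m : M) (y : Fin n → Y) :
    distOf p (fun ω => (ω.1, ω.2.2.1)) (m, y)
      = jn PM PW f (fun _ x y => ∑ z, Q x (y, z)) m y := by
  unfold distOf jn
  simp only [Fintype.sum_prod_type, Prod.mk.injEq, ite_and, hp]
  rw [Finset.sum_eq_single m (fun b _ hb => by simp [hb]) (by simp)]
  refine Finset.sum_congr rfl fun w _ => ?_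
  rw [Finset.sum_eq_single y (fun b _ hb => by simp [hb]) (by simp)]
  simp only [if_true]
  rw [← Finset.mul_sum, sum_prod_pi (fun i z => Q (f m w i) (y i, z))]

theorem distOf_multi_Z {M W X Y Z : Type*} [Fintype M] [Fintype W] [Fintype Y] [Fintype Z]
    [DecidableEq M] [DecidableEq Z] {n : ℕ} (Q : X → Y × Z → ℝ) (PM : M → ℝ) (PW : W → ℝ)
    (f : M → W → Fin n → X) (p : M × W × (Fin n → Y) × (Fin n → Z) → ℝ)
    (hp : ∀ m w y z, p (m, w, y, z) = PM m * PW w * ∏ i, Q (f m w i) (y i, z i))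
    (m : M) (z : Fin n → Z) :
    distOf p (fun ω => (ω.1, ω.2.2.2)) (m, z)
      = jn PM PW f (fun _ x z => ∑ y, Q x (y, z)) m z := by
  unfold distOf jn
  simp only [Fintype.sum_prod_type, Prod.mk.injEq, ite_and, hp]
  rw [Finset.sum_eq_single m (fun b _ hb => by simp [hb]) (by simp)]
  refine Finset.sum_congr rfl fun w _ => ?_
  simp only [if_true, Finset.sum_ite_eq', Finset.sum_ite_eq, Finset.mem_univ]
  rw [← Finset.mul_sum, sum_prod_pi (fun i y => Q (f m w i) (y, z i))]

/-- single-letterization, equations (32)–(34).  For a memoryless channel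
`Q_{YZ|X}` used `n` times with input `Xⁿ = f(M,W)` where `W ⊥ M`,
`(1/n)[I(M;Yⁿ) − I(M;Zⁿ)] ≤ max_{Q_{VX}} [I(V;Y) − I(V;Z)]`, the maximum (here a `sSup`)
being over joint distributions `Q_{VX}` with `V` on an alphabet of cardinality at most
`|𝒳|`, with `(V,X,Y,Z) ~ Q_{VX}(v,x)·Q_{YZ|X}(y,z|x)` (Markov chain `V−X−(Y,Z)`). -/
theorem stmt6 {Mt Wt Xc Yc Zc : Type*}
    [Fintype Mt] [Fintype Wt] [Fintype Xc] [Fintype Yc] [Fintype Zc]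
    [DecidableEq Mt] [DecidableEq Yc] [DecidableEq Zc]
    (n : ℕ) (hn : 0 < n)
    (Q : Xc → Yc × Zc → ℝ) (hQ : ∀ x, IsDist (Q x))
    (PM : Mt → ℝ) (hPM : IsDist PM) (PW : Wt → ℝ) (hPW : IsDist PW)
    (f : Mt → Wt → Fin n → Xc)
    (p : Mt × Wt × (Fin n → Yc) × (Fin n → Zc) → ℝ)
    (hp : ∀ m w y z, p (m, w, y, z) = PM m * PW w * ∏ i, Q (f m w i) (y i, z i)) :
    (1 / (n : ℝ)) * (miRV p (fun ω => ω.1) (fun ω => ω.2.2.1)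
        - miRV p (fun ω => ω.1) (fun ω => ω.2.2.2))
      ≤ sSup { r : ℝ | ∃ k : ℕ, k ≤ Fintype.card Xc ∧
          ∃ QVX : Fin k × Xc → ℝ, IsDist QVX ∧
            r = miRV (fun ω : Fin k × Xc × Yc × Zc =>
                    QVX (ω.1, ω.2.1) * Q ω.2.1 (ω.2.2.1, ω.2.2.2))
                  (fun ω => ω.1) (fun ω => ω.2.2.1)
              - miRV (fun ω : Fin k × Xc × Yc × Zc =>
                    QVX (ω.1, ω.2.1) * Q ω.2.1 (ω.2.2.1, ω.2.2.2))
                  (fun ω => ω.1) (fun ω => ω.2.2.2) } := by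
  set KY : Xc → Yc → ℝ := fun x y => ∑ z, Q x (y, z) with hKY
  set KZ : Xc → Zc → ℝ := fun x z => ∑ y, Q x (y, z) with hKZ
  have hKY0 : ∀ x y, 0 ≤ KY x y := fun x y => Finset.sum_nonneg fun z _ => (hQ x).1 _
  have hKZ0 : ∀ x z, 0 ≤ KZ x z := fun x z => Finset.sum_nonneg fun y _ => (hQ x).1 _
  have hKY1 : ∀ x, ∑ y, KY x y = 1 := fun x => by
    rw [← (hQ x).2, Fintype.sum_prod_type]
  have hKZ1 : ∀ x, ∑ z, KZ x z = 1 := fun x => by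
    rw [← (hQ x).2, Fintype.sum_prod_type, Finset.sum_comm]
  have hlog : 0 < Real.log 2 := Real.log_pos (by norm_num)
  set A : Set ℝ := { r : ℝ | ∃ k : ℕ, k ≤ Fintype.card Xc ∧
          ∃ QVX : Fin k × Xc → ℝ, IsDist QVX ∧
            r = miRV (fun ω : Fin k × Xc × Yc × Zc =>
                    QVX (ω.1, ω.2.1) * Q ω.2.1 (ω.2.2.1, ω.2.2.2))
                  (fun ω => ω.1) (fun ω => ω.2.2.1)
              - miRV (fun ω : Fin k × Xc × Yc × Zc =>
                    QVX (ω.1, ω.2.1) * Q ω.2.1 (ω.2.2.1, ω.2.2.2))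
                  (fun ω => ω.1) (fun ω => ω.2.2.2) } with hA
  -- boundedness
  have hbdd : BddAbove A := by
    refine ⟨(2 * ((Fintype.card Yc : ℝ) + Fintype.card Zc)) / Real.log 2, ?_⟩
    rintro r ⟨k, hk, q, hq, rfl⟩
    rw [single_val q hq.1 Q (fun x => (hQ x).1)]
    refine div_le_div_of_nonneg_right ?_ hlog.le
    have hm : ∑ v, ∑ x, q (v, x) = 1 := by rw [← hq.2, Fintype.sum_prod_type]
    have b1 := gd_bound KY KZ hKY0 hKZ0 hKY1 hKZ1 (fun x => ∑ v, q (v, x))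
      (fun x => Finset.sum_nonneg fun v _ => hq.1 _)
    rw [Finset.sum_comm, hm] at b1
    have b2 : ∑ v, - gd KY KZ (fun x => q (v, x))
        ≤ ∑ v, ((Fintype.card Yc : ℝ) + Fintype.card Zc) * ∑ x, q (v, x) :=
      Finset.sum_le_sum fun v _ => (neg_le_abs _).trans
        (gd_bound KY KZ hKY0 hKZ0 hKY1 hKZ1 (fun x => q (v, x)) (fun x => hq.1 _))
    rw [← Finset.mul_sum, hm, Finset.sum_neg_distrib] at b2
    have b3 := (le_abs_self _).trans b1
    linarith
  -- single-letter bound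
  have hsl : ∀ r : Mt → Xc → ℝ, (∀ m x, 0 ≤ r m x) →
      gd KY KZ (fun x => ∑ m, r m x) - ∑ m, gd KY KZ (r m)
        ≤ (sSup A * Real.log 2) * ∑ m, ∑ x, r m x := by
    intro r hr
    obtain ⟨k, hk, r', h1, h2, h3⟩ := card_reduce (gd KY KZ) (gd_smul KY KZ hKY1 hKZ1)
      _ (Finset.univ : Finset Mt) le_rfl r hr
    have hmass : ∑ v, ∑ x, r' v x = ∑ m, ∑ x, r m x := by
      rw [Finset.sum_comm]
      simp_rw [h2]
      rw [Finset.sum_comm]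
    have hc0 : 0 ≤ ∑ m, ∑ x, r m x :=
      Finset.sum_nonneg fun m _ => Finset.sum_nonneg fun x _ => hr m x
    set c := ∑ m, ∑ x, r m x with hcdef
    have hle : gd KY KZ (fun x => ∑ m, r m x) - ∑ m, gd KY KZ (r m)
        ≤ gd KY KZ (fun x => ∑ v, r' v x) - ∑ v, gd KY KZ (r' v) := by
      simp_rw [h2]; linarith
    refine hle.trans ?_
    rcases hc0.eq_or_lt with hc | hc
    · have hz : ∀ v, ∑ x, r' v x = 0 := fun v =>
        (Finset.sum_eq_zero_iff_of_nonneg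
          (fun v _ => Finset.sum_nonneg fun x _ => h1 v x)).1 (hmass.trans hc.symm) v
          (Finset.mem_univ v)
      have g1 : ∀ v, gd KY KZ (r' v) = 0 := fun v => by
        have := gd_bound KY KZ hKY0 hKZ0 hKY1 hKZ1 (r' v) (h1 v)
        rw [hz v, mul_zero] at this
        exact abs_nonpos_iff.1 this
      have g2 : gd KY KZ (fun x => ∑ v, r' v x) = 0 := by
        have := gd_bound KY KZ hKY0 hKZ0 hKY1 hKZ1 (fun x => ∑ v, r' v x)
          (fun x => Finset.sum_nonneg fun v _ => h1 v x)
        rw [Finset.sum_comm, hmass, ← hc, mul_zero] at this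
        exact abs_nonpos_iff.1 this
      rw [g2, ← hc]
      simp [g1]
    · have hq : IsDist (fun a : Fin k × Xc => c⁻¹ * r' a.1 a.2) := by
        refine ⟨fun a => mul_nonneg (inv_nonneg.2 hc0) (h1 _ _), ?_⟩
        rw [← Finset.mul_sum, Fintype.sum_prod_type, hmass]
        exact inv_mul_cancel₀ hc.ne'
      have hmem := le_csSup hbdd (show _ ∈ A from ⟨k, hk, _, hq, rfl⟩)
      rw [single_val _ hq.1 Q (fun x => (hQ x).1), div_le_iff₀ hlog] at hmem
      have e1 : gd KY KZ (fun x => ∑ v, c⁻¹ * r' v x) = c⁻¹ * gd KY KZ (fun x => ∑ v, r' v x) := by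
        simp_rw [← Finset.mul_sum]
        exact gd_smul KY KZ hKY1 hKZ1 _ _
      have e2 : ∀ v, gd KY KZ (fun x => c⁻¹ * r' v x) = c⁻¹ * gd KY KZ (r' v) :=
        fun v => gd_smul KY KZ hKY1 hKZ1 _ _
      have hmem' : gd KY KZ (fun x => ∑ v, c⁻¹ * r' v x)
          - ∑ v, gd KY KZ (fun x => c⁻¹ * r' v x) ≤ sSup A * Real.log 2 := hmem
      simp_rw [e2] at hmem'
      rw [e1, ← Finset.mul_sum, ← mul_sub] at hmem'
      have := mul_le_mul_of_nonneg_left hmem' hc0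
      rw [mul_inv_cancel_left₀ hc.ne'] at this
      linarith
  -- common output alphabet
  have eY : ∀ x (a : Yc ⊕ Zc), a ∉ Set.range (Sum.inl : Yc → Yc ⊕ Zc) →
      (Sum.elim (KY x) (fun _ => 0) : Yc ⊕ Zc → ℝ) a = 0 := by
    rintro x (a | a) h
    · exact absurd ⟨a, rfl⟩ h
    · rfl
  have eZ : ∀ x (a : Yc ⊕ Zc), a ∉ Set.range (Sum.inr : Zc → Yc ⊕ Zc) →
      (Sum.elim (fun _ => 0) (KZ x) : Yc ⊕ Zc → ℝ) a = 0 := by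
    rintro x (a | a) h
    · rfl
    · exact absurd ⟨a, rfl⟩ h
  have htele := phi_tele PM hPM PW hPW f
    (fun x => (Sum.elim (KY x) (fun _ => 0) : Yc ⊕ Zc → ℝ))
    (fun x => (Sum.elim (fun _ => 0) (KZ x) : Yc ⊕ Zc → ℝ))
    (by rintro x (a | a); exacts [hKY0 x a, le_rfl])
    (by intro x; simp [hKY1])
    (by rintro x (a | a); exacts [le_rfl, hKZ0 x a])
    (by intro x; simp [hKZ1]) (sSup A * Real.log 2)
    (by
      intro r hr
      have hg : ∀ s : Xc → ℝ, gd (fun x => (Sum.elim (KY x) (fun _ => 0) : Yc ⊕ Zc → ℝ))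
          (fun x => (Sum.elim (fun _ => 0) (KZ x) : Yc ⊕ Zc → ℝ)) s = gd KY KZ s := by
        intro s
        unfold gd
        rw [hc_ext Sum.inl Sum.inl_injective _ eY, hc_ext Sum.inr Sum.inr_injective _ eZ]
        rfl
      simp_rw [hg]
      exact hsl r hr)
  rw [phi_ext PM PW f Sum.inl Sum.inl_injective _ eY,
    phi_ext PM PW f Sum.inr Sum.inr_injective _ eZ] at htele
  simp only [Sum.elim_inl, Sum.elim_inr] at htele
  have hp0 : ∀ ω, 0 ≤ p ω := by
    rintro ⟨m, w, y, z⟩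
    rw [hp]
    exact mul_nonneg (mul_nonneg (hPM.1 m) (hPW.1 w))
      (Finset.prod_nonneg fun i _ => (hQ _).1 _)
  rw [miRV_phi p hp0 _ _ _ (distOf_multi_Y Q PM PW f p hp),
    miRV_phi p hp0 _ _ _ (distOf_multi_Z Q PM PW f p hp), ← sub_div, add_sub_add_left_eq_sub]
  have hn' : (0 : ℝ) < n := by exact_mod_cast hn
  rw [one_div, inv_mul_le_iff₀ hn', div_le_iff₀ hlog, mul_assoc]
  exact htele
end

section
/- (Theorem 1, achievability direction.) Fix a memoryless wire-tap channel Q_{YZ|X} on finite alphabets 𝒳, 𝒴, 𝒵, a joint distribution Q_{VX} (with finite auxiliary alphabet 𝒱 and Markov chain V − X − (Y,Z)), and let Q_Z be the induced per-letter output distribution at the eavesdropper. Then every rate R with 0 ≤ R < I(V;Y) − I(V;Z) is achievable: for every ξ₁, ξ₂ > 0 there exist a sufficiently large n, an L₁, an encoder f : {1,…,⌈2^{nR}⌉} × {1,…,L₁} → 𝒳ⁿ (with M and W uniform and independent) and a decoder d : 𝒴ⁿ → {1,…,⌈2^{nR}⌉} such that Pr[d(Yⁿ) ≠ M] ≤ ξ₁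 and D(P_{MZⁿ} || P_M × Qⁿ_Z) ≤ ξ₂, where Qⁿ_Z is the n-fold product of Q_Z. In particular both I(M;Zⁿ) ≤ ξ₂ and D(P_{Zⁿ} || Qⁿ_Z) ≤ ξ₂ (effective secrecy: confusion and stealth). -/
open Finset

/-- The joint distribution of `(M, W, Yⁿ, Zⁿ)` induced by a wire-tap code: `M` uniform on
`Fin L`, `W` uniform on `Fin L₁` independent of `M`, input `Xⁿ = f(M,W)`, and the
memoryless channel `Q_{YZ|X}` used `n` times. -/
noncomputable def wtJoint {Xc Yc Zc : Type*} [Fintype Xc] [Fintype Yc] [Fintype Zc]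
    (Q : Xc → Yc × Zc → ℝ) (n L L₁ : ℕ) (f : Fin L × Fin L₁ → Fin n → Xc) :
    Fin L × Fin L₁ × (Fin n → Yc) × (Fin n → Zc) → ℝ :=
  fun ω => (1 / ((L : ℝ) * (L₁ : ℝ))) * ∏ i, Q (f (ω.1, ω.2.1) i) (ω.2.2.1 i, ω.2.2.2 i)

/-- Average error probability `Pr[d(Yⁿ) ≠ M]` of a wire-tap code. -/
noncomputable def wtPerr {Xc Yc Zc : Type*} [Fintype Xc] [Fintype Yc] [Fintype Zc]
    (Q : Xc → Yc × Zc → ℝ) (n L L₁ : ℕ) (f : Fin L × Fin L₁ → Fin n → Xc)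
    (d : (Fin n → Yc) → Fin L) : ℝ :=
  ∑ ω : Fin L × Fin L₁ × (Fin n → Yc) × (Fin n → Zc),
    if d ω.2.2.1 = ω.1 then 0 else wtJoint Q n L L₁ f ω

/-- Effective-secrecy metric `D(P_{MZⁿ} || P_M × Qⁿ_Z)` of a wire-tap code, where `Qⁿ_Z`
is the `n`-fold product of the per-letter distribution `QZ`. -/
noncomputable def wtDsec {Xc Yc Zc : Type*} [Fintype Xc] [Fintype Yc] [Fintype Zc]
    [DecidableEq Zc]
    (Q : Xc → Yc × Zc → ℝ) (n L L₁ : ℕ) (f : Fin L × Fin L₁ → Fin n → Xc)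
    (QZ : Zc → ℝ) : ℝ :=
  KL (distOf (wtJoint Q n L L₁ f) (fun ω => (ω.1, ω.2.2.2)))
     (fun mz => distOf (wtJoint Q n L L₁ f) (fun ω => ω.1) mz.1 * ∏ i, QZ (mz.2 i))

theorem aux_exists_s {ι : Type*} [Fintype ι] (w x : ι → ℝ) (hw : ∀ i, 0 ≤ w i)
    (hsum : ∑ i, w i = 1) (hx : ∀ i, 0 < w i → 0 < x i)
    (h : ∑ i, w i * Real.log (x i) < 0) :
    ∃ s : ℝ, 0 < s ∧ s ≤ 1 ∧ ∑ i, w i * x i ^ s < 1 := by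
  set g : ℝ → ℝ := fun s => ∑ i, w i * Real.exp (s * Real.log (x i)) with hg
  have hd : HasDerivAt g (∑ i, w i * Real.log (x i)) 0 := by
    rw [hg]
    apply HasDerivAt.fun_sum
    intro i _
    have h1 : HasDerivAt (fun s : ℝ => s * Real.log (x i)) (Real.log (x i)) 0 := by
      simpa using (hasDerivAt_id (0:ℝ)).mul_const (Real.log (x i))
    simpa using (h1.exp).const_mul (w i)
  have hg0 : g 0 = 1 := by simp [hg, hsum]
  have hs := hd.tendsto_slope_zero_right
  have hev : ∀ᶠ t in nhdsWithin (0:ℝ) (Set.Ioi 0), t⁻¹ • (g (0 + t) - g 0) < 0 :=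
    hs.eventually_lt_const h
  have hI : Set.Ioc (0:ℝ) 1 ∈ nhdsWithin (0:ℝ) (Set.Ioi 0) := Ioc_mem_nhdsGT one_pos
  obtain ⟨t, ht, ht2⟩ := (hev.and hI).exists
  refine ⟨t, ht2.1, ht2.2, ?_⟩
  have e : ∑ i, w i * x i ^ t = g t := by
    rw [hg]
    refine Finset.sum_congr rfl fun i _ => ?_
    rcases (hw i).eq_or_lt with h0 | h0
    · simp [← h0]
    · rw [Real.rpow_def_of_pos (hx i h0), mul_comm t]
  rw [e]
  rw [hg0, zero_add, smul_eq_mul] at ht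
  have h5 : t * (t⁻¹ * (g t - 1)) < 0 := mul_neg_of_pos_of_neg ht2.1 ht
  rw [mul_inv_cancel_left₀ ht2.1.ne'] at h5
  linarith

theorem aux_log_le {x s : ℝ} (hx : 0 ≤ x) (hs : 0 < s) (hs1 : s ≤ 1) :
    Real.log (1 + x) ≤ x ^ s / s := by
  have h1 : (1 + x) ^ s ≤ 1 + x ^ s := by
    simpa using Real.rpow_add_le_add_rpow (zero_le_one) hx hs.le hs1
  have h2 : Real.log ((1 + x) ^ s) ≤ x ^ s := by
    have := Real.log_le_sub_one_of_pos (x := (1 + x) ^ s) (by positivity)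
    linarith
  rw [Real.log_rpow (by linarith)] at h2
  rw [le_div_iff₀ hs]; linarith

/-- expectation over i.i.d. random codebooks -/
noncomputable def EE {ι U : Type*} [Fintype ι] [DecidableEq ι] [Fintype U] (p : U → ℝ) (F : (ι → U) → ℝ) : ℝ :=
  ∑ c : ι → U, (∏ i, p (c i)) * F c

section EEsec
variable {ι U : Type*} [Fintype ι] [DecidableEq ι] [Fintype U] (p : U → ℝ)

theorem EE_prod (g : ι → U → ℝ) : EE p (fun c => ∏ i, g i (c i)) = ∏ i, ∑ u, p u * g i u := by
  unfold EE
  rw [Finset.prod_univ_sum]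
  simp [Finset.prod_mul_distrib]

theorem EE_one (hp : ∑ u, p u = 1) (i : ι) (h : U → ℝ) :
    EE p (fun c => h (c i)) = ∑ u, p u * h u := by
  have := EE_prod p (fun j u => if j = i then h u else 1)
  simp only [Finset.prod_ite_eq', Finset.mem_univ, if_true] at this
  rw [this, Finset.prod_eq_single i]
  · simp
  · intro b _ hb; simp [hb, hp]
  · simp

theorem EE_two (hp : ∑ u, p u = 1) {i j : ι} (hij : i ≠ j) (h k : U → ℝ) :
    EE p (fun c => h (c i) * k (c j)) = (∑ u, p u * h u) * (∑ u, p u * k u) := by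
  have := EE_prod p (fun l u => (if l = i then h u else 1) * (if l = j then k u else 1))
  simp only [Finset.prod_mul_distrib, Finset.prod_ite_eq', Finset.mem_univ, if_true] at this
  rw [this, Finset.prod_eq_mul i j hij]
  · simp [hij, hij.symm]
  · intro b _ hb; simp [hb.1, hb.2, hp]
  · simp
  · simp

theorem EE_add (F G : (ι → U) → ℝ) : EE p (fun c => F c + G c) = EE p F + EE p G := by
  simp [EE, mul_add, Finset.sum_add_distrib]
theorem EE_sub (F G : (ι → U) → ℝ) : EE p (fun c => F c - G c) = EE p F - EE p G := by
  simp [EE, mul_sub, Finset.sum_sub_distrib]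
theorem EE_mul (a : ℝ) (F : (ι → U) → ℝ) : EE p (fun c => a * F c) = a * EE p F := by
  simp only [EE, Finset.mul_sum]
  exact Finset.sum_congr rfl fun c _ => by ring
theorem EE_const (hp : ∑ u, p u = 1) (a : ℝ) : EE p (fun _ : ι → U => a) = a := by
  have := EE_prod (ι := ι) p (fun _ _ => 1)
  simp [hp] at this
  have h2 := EE_mul (ι := ι) p a (fun _ => 1)
  simpa [this] using h2
theorem EE_sum {κ : Type*} (T : Finset κ) (F : κ → (ι → U) → ℝ) :
    EE p (fun c => ∑ k ∈ T, F k c) = ∑ k ∈ T, EE p (F k) := by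
  simp only [EE, Finset.mul_sum]
  exact Finset.sum_comm
theorem EE_mono (hp : ∀ u, 0 ≤ p u) {F G : (ι → U) → ℝ} (h : ∀ c, F c ≤ G c) :
    EE p F ≤ EE p G :=
  Finset.sum_le_sum fun c _ => mul_le_mul_of_nonneg_left (h c) (Finset.prod_nonneg fun _ _ => hp _)
theorem EE_exists (hp : ∀ u, 0 ≤ p u) (hp1 : ∑ u, p u = 1) (F : (ι → U) → ℝ) {e : ℝ}
    (h : EE p F < e) : ∃ c, F c < e := by
  by_contra! hc
  have := EE_mono p hp (F := fun _ => e) (G := F) hc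
  rw [EE_const p hp1] at this
  linarith

/-- the decoupling term has zero mean -/
theorem EE_cross (hp : ∑ u, p u = 1) (T : Finset ι) (i : ι) (b k : U → ℝ) (q : ℝ)
    (hq : ∑ u, p u * b u = q) :
    EE p (fun c => k (c i) * (∑ j ∈ T.erase i, b (c j) - (T.erase i).card * q)) = 0 := by
  have e : (fun c : ι → U => k (c i) * (∑ j ∈ T.erase i, b (c j) - (T.erase i).card * q)) =
      fun c => ∑ j ∈ T.erase i, k (c i) * (b (c j) - q) := by
    funext c
    rw [← Finset.mul_sum, Finset.sum_sub_distrib]; simp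
  rw [e, EE_sum]
  refine Finset.sum_eq_zero fun j hj => ?_
  rw [EE_two p hp (Finset.ne_of_mem_erase hj).symm k (fun u => b u - q)]
  simp [mul_sub, Finset.sum_sub_distrib, hq, ← Finset.sum_mul, hp]
end EEsec

theorem aux_pt_log {a x μ r : ℝ} (ha : 0 ≤ a) (hx : 0 ≤ x) (hμ : 0 ≤ μ) (hr : 0 ≤ r)
    (hrμ : r = 0 → μ = 0) :
    a * Real.log ((a + x) / r) ≤ a * Real.log ((a + μ) / r) + a / (a + μ) * (x - μ) := by
  rcases ha.eq_or_lt with h | ha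
  · simp [← h]
  rcases hr.eq_or_lt with h | hr
  · rw [← h, hrμ h.symm]; simp; positivity
  · rw [Real.log_div (by positivity) hr.ne', Real.log_div (by positivity) hr.ne']
    have h1 := Real.log_le_sub_one_of_pos (x := (a + x) / (a + μ)) (by positivity)
    rw [Real.log_div (by positivity) (by positivity)] at h1
    have h2 : (a + x) / (a + μ) - 1 = (x - μ) / (a + μ) := by field_simp; ring
    rw [h2] at h1
    have := mul_le_mul_of_nonneg_left h1 ha.le
    have h3 : a / (a + μ) * (x - μ) = a * ((x - μ) / (a + μ)) := by ring
    rw [h3]; linarith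

theorem aux_pt_inv {a x μ : ℝ} (ha : 0 ≤ a) (hx : 0 ≤ x) (hμ : 0 ≤ μ) :
    a ^ 2 / (a + μ) - (a / (a + μ)) ^ 2 * (x - μ) ≤ a ^ 2 / (a + x) := by
  rcases ha.eq_or_lt with h | ha
  · simp [← h]
  have : a ^ 2 / (a + x) - (a ^ 2 / (a + μ) - (a / (a + μ)) ^ 2 * (x - μ)) =
      a ^ 2 * (x - μ) ^ 2 / ((a + x) * (a + μ) ^ 2) := by
    field_simp; ring
  have h2 : 0 ≤ a ^ 2 * (x - μ) ^ 2 / ((a + x) * (a + μ) ^ 2) := by positivity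
  linarith

theorem aux_resolv {ι U Z : Type*} [Fintype ι] [DecidableEq ι] [Fintype U] [Fintype Z]
    (p : U → ℝ) (hp0 : ∀ u, 0 ≤ p u) (hp : ∑ u, p u = 1) (B : U → Z → ℝ) (hB : ∀ u z, 0 ≤ B u z)
    (q : Z → ℝ) (hq : ∀ z, ∑ u, p u * B u z = q z) (T : Finset ι) (hT : T.Nonempty)
    {s : ℝ} (hs : 0 < s) (hs1 : s ≤ 1) :
    EE p (fun c : ι → U => ∑ z, ((∑ w ∈ T, B (c w) z) / T.card) *
        Real.log (((∑ w ∈ T, B (c w) z) / T.card) / q z)) ≤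
      (1 / s) * ∑ u, ∑ z, p u * B u z * (B u z / (T.card * q z)) ^ s := by
  have hK : (0:ℝ) < T.card := by exact_mod_cast hT.card_pos
  have hq0 : ∀ z, 0 ≤ q z := fun z => by
    rw [← hq]; exact Finset.sum_nonneg fun u _ => mul_nonneg (hp0 u) (hB u z)
  rw [EE_sum, Finset.sum_comm, Finset.mul_sum]
  refine Finset.sum_le_sum fun z _ => ?_
  set μ : ℝ := ((T.card : ℝ) - 1) * q z with hμ
  have hK1 : (1:ℝ) ≤ T.card := by exact_mod_cast hT.card_pos
  have hμ0 : 0 ≤ μ := mul_nonneg (by linarith) (hq0 z)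
  calc _ ≤ EE p (fun c : ι → U => (1 / (T.card : ℝ)) * ∑ w ∈ T, (B (c w) z *
            Real.log ((B (c w) z + μ) / (T.card * q z)) + B (c w) z / (B (c w) z + μ) *
            (∑ j ∈ T.erase w, B (c j) z - (T.erase w).card * q z))) := by
        refine EE_mono p hp0 fun c => ?_
        rw [div_div, div_mul_eq_mul_div, div_eq_inv_mul, ← one_div]
        refine mul_le_mul_of_nonneg_left ?_ (by positivity)
        rw [Finset.sum_mul]
        refine Finset.sum_le_sum fun w hw => ?_
        rw [← Finset.add_sum_erase T _ hw]
        have hc : ((T.erase w).card : ℝ) * q z = μ := by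
          rw [Finset.card_erase_of_mem hw, Nat.cast_sub hT.card_pos, hμ]; simp
        rw [hc]
        refine aux_pt_log (hB _ _) (Finset.sum_nonneg fun j _ => hB _ _) hμ0
          (mul_nonneg hK.le (hq0 z)) fun h => ?_
        rcases mul_eq_zero.1 h with h | h
        · linarith
        · simp [hμ, h]
    _ = ∑ u, p u * (B u z * Real.log ((B u z + μ) / (T.card * q z))) := by
        rw [EE_mul, EE_sum]
        have : ∀ w ∈ T, EE p (fun c : ι → U => (B (c w) z *
            Real.log ((B (c w) z + μ) / (T.card * q z)) + B (c w) z / (B (c w) z + μ) *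
            (∑ j ∈ T.erase w, B (c j) z - (T.erase w).card * q z))) = 
            ∑ u, p u * (B u z * Real.log ((B u z + μ) / (T.card * q z))) := by
          intro w hw
          rw [EE_add, EE_cross p hp T w (fun u => B u z) (fun u => B u z / (B u z + μ)) (q z) (hq z),
            EE_one p hp w (fun u => B u z * Real.log ((B u z + μ) / (T.card * q z))), add_zero]
        rw [Finset.sum_congr rfl this, Finset.sum_const, nsmul_eq_mul]
        field_simp
    _ ≤ _ := by
        rw [Finset.mul_sum]
        refine Finset.sum_le_sum fun u _ => ?_
        rw [← mul_assoc, mul_left_comm]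
        refine mul_le_mul_of_nonneg_left ?_ (mul_nonneg (hp0 u) (hB u z))
        have hx : 0 ≤ B u z / (T.card * q z) := div_nonneg (hB _ _) (mul_nonneg hK.le (hq0 z))
        refine le_trans ?_ ((aux_log_le hx hs hs1).trans_eq (by ring))
        rcases (hq0 z).eq_or_lt with h | h
        · simp [← h]
        · rcases (add_nonneg (hB u z) hμ0).eq_or_lt with h0 | h0
          · rw [← h0]; simp; exact Real.log_nonneg (by linarith)
          refine Real.log_le_log (by positivity) ?_
          rw [div_le_iff₀ (by positivity), add_mul, div_mul_cancel₀ _ (by positivity), hμ]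
          nlinarith

theorem aux_correct {M W U Y : Type*} [Fintype M] [DecidableEq M] [Nonempty M] [Fintype W] [DecidableEq W]
    [Nonempty W] [Fintype U] [Fintype Y]
    (p : U → ℝ) (hp0 : ∀ u, 0 ≤ p u) (hp : ∑ u, p u = 1) (A : U → Y → ℝ) (hA : ∀ u y, 0 ≤ A u y)
    (hA1 : ∀ u, ∑ y, A u y = 1)
    (q : Y → ℝ) (hq : ∀ y, ∑ u, p u * A u y = q y) 
    (d : (M × W → U) → Y → M)
    (hd : ∀ (c : M × W → U) (y : Y) (m : M), ∑ w, A (c (m, w)) y ≤ ∑ w, A (c (d c y, w)) y)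
    {s : ℝ} (hs : 0 < s) (hs1 : s ≤ 1) :
    1 - ∑ u, ∑ y, p u * A u y * ((Fintype.card (M × W)) * q y / A u y) ^ s ≤ 
    EE p (fun c : M × W → U => (1 / (Fintype.card (M × W) : ℝ)) * ∑ y, ∑ w, A (c (d c y, w)) y) := by
  set N : ℝ := (Fintype.card (M × W) : ℝ) with hN
  have hN1 : 1 ≤ N := by rw [hN]; exact_mod_cast Fintype.card_pos
  have hq0 : ∀ y, 0 ≤ q y := fun z => by
    rw [← hq]; exact Finset.sum_nonneg fun u _ => mul_nonneg (hp0 u) (hA u z)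
  set μ : Y → ℝ := fun y => (N - 1) * q y with hμ
  have hμ0 : ∀ y, 0 ≤ μ y := fun y => mul_nonneg (by linarith) (hq0 y)
  calc _ ≤ ∑ u, ∑ y, p u * (A u y ^ 2 / (A u y + μ y)) := by
        have : (1:ℝ) = ∑ u, ∑ y, p u * A u y := by
          simp [← Finset.mul_sum, hA1, hp]
        conv_lhs => rw [this]
        simp only [← Finset.sum_sub_distrib]
        refine Finset.sum_le_sum fun u _ => Finset.sum_le_sum fun y _ => ?_
        rw [mul_assoc, ← mul_sub]
        refine mul_le_mul_of_nonneg_left ?_ (hp0 u)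
        rcases (hA u y).eq_or_lt with h | h
        · simp [← h]
        set t := N * q y / A u y with ht
        have ht0 : 0 ≤ t := div_nonneg (mul_nonneg (by linarith) (hq0 y)) h.le
        have e1 : A u y ^ 2 / (A u y + μ y) = A u y * (A u y / (A u y + μ y)) := by ring
        have e2 : A u y - A u y * t ^ s = A u y * (1 - t ^ s) := by ring
        rw [e1, e2]
        refine mul_le_mul_of_nonneg_left ?_ h.le
        have h3 : 0 < A u y + μ y := by linarith [hμ0 y]
        rcases le_total t 1 with h1 | h1
        · have h2 : t ≤ t ^ s := by
            rcases ht0.eq_or_lt with h0 | h0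
            · rw [← h0, Real.zero_rpow hs.ne']
            · simpa using Real.rpow_le_rpow_of_exponent_ge h0 h1 hs1
          have : A u y / (A u y + μ y) - (1 - t) = (q y + t * μ y) / (A u y + μ y) := by
            have e3 : t * A u y = μ y + q y := by rw [ht, hμ]; field_simp; ring
            rw [eq_div_iff h3.ne', sub_mul, div_mul_cancel₀ _ h3.ne']
            linear_combination e3
          have : 0 ≤ (q y + t * μ y) / (A u y + μ y) := 
            div_nonneg (add_nonneg (hq0 y) (mul_nonneg ht0 (hμ0 y))) h3.le
          linarith
        · have : 1 ≤ t ^ s := Real.one_le_rpow h1 hs.le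
          have : 0 ≤ A u y / (A u y + μ y) := by positivity
          linarith
    _ = EE p (fun c : M × W → U => (1 / N) * ∑ y, ∑ i, (A (c i) y ^ 2 / (A (c i) y + μ y) -
          (A (c i) y / (A (c i) y + μ y)) ^ 2 * (∑ j ∈ univ.erase i, A (c j) y - (univ.erase i).card * q y))) := by
        rw [EE_mul, EE_sum, Finset.sum_comm, Finset.mul_sum]
        refine Finset.sum_congr rfl fun y _ => ?_
        rw [EE_sum]
        have : ∀ i : M × W, EE p (fun c : M × W → U => (A (c i) y ^ 2 / (A (c i) y + μ y) -
          (A (c i) y / (A (c i) y + μ y)) ^ 2 * (∑ j ∈ univ.erase i, A (c j) y - (univ.erase i).card * q y)))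
          = ∑ u, p u * (A u y ^ 2 / (A u y + μ y)) := by
          intro i
          rw [EE_sub, EE_cross p hp univ i (fun u => A u y) (fun u => (A u y / (A u y + μ y)) ^ 2) (q y) (hq y),
            EE_one p hp i (fun u => A u y ^ 2 / (A u y + μ y)), sub_zero]
        rw [Finset.sum_congr rfl fun i _ => this i, Finset.sum_const, nsmul_eq_mul, Finset.card_univ, ← hN]
        field_simp
    _ ≤ _ := by
        refine EE_mono p hp0 fun c => ?_
        refine mul_le_mul_of_nonneg_left ?_ (by positivity)
        refine Finset.sum_le_sum fun y _ => ?_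
        calc _ ≤ ∑ i, A (c i) y ^ 2 / ∑ j, A (c j) y := by
              refine Finset.sum_le_sum fun i _ => ?_
              rw [← Finset.add_sum_erase univ _ (Finset.mem_univ i)]
              have hc : (((univ : Finset (M × W)).erase i).card : ℝ) * q y = μ y := by
                rw [Finset.card_erase_of_mem (Finset.mem_univ i), Nat.cast_sub (Finset.card_pos.2 ⟨i, Finset.mem_univ i⟩), hμ]
                simp [hN]
              rw [hc]
              exact aux_pt_inv (hA _ _) (Finset.sum_nonneg fun j _ => hA _ _) (hμ0 y)
          _ ≤ _ := by
              rw [← Finset.sum_div]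
              set G := ∑ w, A (c (d c y, w)) y with hG
              have hG0 : 0 ≤ G := Finset.sum_nonneg fun j _ => hA _ _
              refine div_le_of_le_mul₀ (Finset.sum_nonneg fun j _ => hA _ _) hG0 ?_
              rw [Finset.mul_sum]
              refine Finset.sum_le_sum fun i _ => ?_
              rw [pow_two]
              refine mul_le_mul_of_nonneg_right ?_ (hA _ _)
              refine le_trans ?_ (hd c y i.1)
              exact Finset.single_le_sum (f := fun w => A (c (i.1, w)) y) (fun w _ => hA _ _) (Finset.mem_univ i.2)

theorem aux_sum_prod {V Y : Type*} [Fintype V] [Fintype Y] {n : ℕ} (g : Fin n → V → Y → ℝ) :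
    ∑ u : Fin n → V, ∑ y : Fin n → Y, ∏ i, g i (u i) (y i) = ∏ i, ∑ v, ∑ y, g i v y := by
  classical
  rw [Finset.prod_univ_sum]
  simp only [Fintype.piFinset_univ]
  refine Finset.sum_congr rfl fun u _ => ?_
  rw [Finset.prod_univ_sum]
  simp only [Fintype.piFinset_univ]

theorem aux_sum_prod1 {V : Type*} [Fintype V] {n : ℕ} (g : Fin n → V → ℝ) :
    ∑ u : Fin n → V, ∏ i, g i (u i) = ∏ i, ∑ v, g i v := by
  classical
  rw [Finset.prod_univ_sum]
  simp only [Fintype.piFinset_univ]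

theorem aux_gibbs {α : Type*} [Fintype α] (P R : α → ℝ) (hP : ∀ x, 0 ≤ P x) (hR : ∀ x, 0 ≤ R x)
    (hP1 : ∑ x, P x = 1) (hR1 : ∑ x, R x ≤ 1) (hs : ∀ x, R x = 0 → P x = 0) :
    0 ≤ ∑ x, P x * Real.log (P x / R x) := by
  have : ∑ x, (P x - R x) ≤ ∑ x, P x * Real.log (P x / R x) := by
    refine Finset.sum_le_sum fun x _ => ?_
    rcases (hP x).eq_or_lt with h | h
    · simp [← h, hR x]
    · have hr : 0 < R x := lt_of_le_of_ne (hR x) fun h0 => h.ne' (hs x h0.symm)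
      have h1 := Real.log_le_sub_one_of_pos (x := R x / P x) (by positivity)
      have h2 : Real.log (P x / R x) = - Real.log (R x / P x) := by
        rw [← Real.log_inv, inv_div]
      rw [h2]
      have h3 := mul_le_mul_of_nonneg_left h1 h.le
      have h4 : P x * (R x / P x - 1) = R x - P x := by field_simp
      linarith
  rw [Finset.sum_sub_distrib] at this
  linarith

/-- single-letter exponent, summed over pairs -/
theorem aux_exists_s2 {V Y : Type*} [Fintype V] [Fintype Y] (p : V → ℝ) (hp0 : ∀ u, 0 ≤ p u)
    (hp : ∑ u, p u = 1) (A : V → Y → ℝ) (hA : ∀ u y, 0 ≤ A u y) (hA1 : ∀ u, ∑ y, A u y = 1)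
    (x : V → Y → ℝ) (hx : ∀ u y, 0 < p u → 0 < A u y → 0 < x u y)
    (h : ∑ u, ∑ y, p u * A u y * Real.log (x u y) < 0) :
    ∃ s : ℝ, 0 < s ∧ s ≤ 1 ∧ ∑ u, ∑ y, p u * A u y * x u y ^ s < 1 := by
  have := aux_exists_s (ι := V × Y) (fun i => p i.1 * A i.1 i.2) (fun i => x i.1 i.2)
    (fun i => mul_nonneg (hp0 _) (hA _ _))
    (by rw [Fintype.sum_prod_type]; simp [← Finset.mul_sum, hA1, hp])
    (fun i hi => hx _ _ (lt_of_le_of_ne (hp0 _) fun h => by simp [← h] at hi)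
      (lt_of_le_of_ne (hA _ _) fun h => by simp [← h] at hi))
    (by rw [Fintype.sum_prod_type]; exact h)
  simpa only [Fintype.sum_prod_type] using this

theorem aux_core {V Y Z : Type*} [Fintype V] [Fintype Y] [Fintype Z]
    (p : V → ℝ) (hp0 : ∀ u, 0 ≤ p u) (hp : ∑ u, p u = 1)
    (A : V → Y → ℝ) (hA : ∀ u y, 0 ≤ A u y) (hA1 : ∀ u, ∑ y, A u y = 1)
    (B : V → Z → ℝ) (hB : ∀ u y, 0 ≤ B u y) (hB1 : ∀ u, ∑ y, B u y = 1)
    (qY : Y → ℝ) (hqY : ∀ y, ∑ u, p u * A u y = qY y)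
    (qZ : Z → ℝ) (hqZ : ∀ z, ∑ u, p u * B u z = qZ z)
    (hBq : ∀ v z, qZ z = 0 → B v z = 0)
    (R : ℝ) (hR0 : 0 ≤ R)
    (hIZ : 0 ≤ ∑ v, ∑ z, p v * B v z * Real.log (B v z / qZ z))
    (hR : R * Real.log 2 < ∑ v, ∑ y, p v * A v y * Real.log (A v y / qY y) -
      ∑ v, ∑ z, p v * B v z * Real.log (B v z / qZ z)) (ξ : ℝ) (hξ : 0 < ξ) :
    ∃ n K : ℕ, 0 < n ∧ 0 < K ∧ ∃ (c : Fin (⌈(2 : ℝ) ^ ((n : ℝ) * R)⌉₊) × Fin K → Fin n → V)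
      (d : (Fin n → Y) → Fin (⌈(2 : ℝ) ^ ((n : ℝ) * R)⌉₊)),
      1 - (1 / (((⌈(2 : ℝ) ^ ((n : ℝ) * R)⌉₊ : ℕ) : ℝ) * (K : ℝ))) * ∑ y, ∑ w, ∏ i, A (c (d y, w) i) (y i) < ξ ∧
      (1 / ((⌈(2 : ℝ) ^ ((n : ℝ) * R)⌉₊ : ℕ) : ℝ)) * ∑ m, ∑ z : Fin n → Z, ((∑ w, ∏ i, B (c (m, w) i) (z i)) / K) *
        Real.log (((∑ w, ∏ i, B (c (m, w) i) (z i)) / K) / ∏ i, qZ (z i)) < ξ := by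
  classical
  set IY := ∑ v, ∑ y, p v * A v y * Real.log (A v y / qY y) with hIYd
  set IZ := ∑ v, ∑ z, p v * B v z * Real.log (B v z / qZ z) with hIZd
  set ρ := R * Real.log 2 with hρ
  have hρ0 : 0 ≤ ρ := mul_nonneg hR0 (Real.log_nonneg (by norm_num))
  obtain ⟨t, ht1, ht2⟩ : ∃ t, IZ < t ∧ ρ + t < IY := ⟨(IZ + (IY - ρ)) / 2, by linarith, by linarith⟩
  have hqY0 : ∀ y, 0 ≤ qY y := fun y => by
    rw [← hqY]; exact Finset.sum_nonneg fun u _ => mul_nonneg (hp0 u) (hA u y)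
  have hqZ0 : ∀ y, 0 ≤ qZ y := fun y => by
    rw [← hqZ]; exact Finset.sum_nonneg fun u _ => mul_nonneg (hp0 u) (hB u y)
  have hqYp : ∀ u y, 0 < p u → 0 < A u y → 0 < qY y := fun u y h1 h2 => by
    rw [← hqY]
    exact (mul_pos h1 h2).trans_le (Finset.single_le_sum (f := fun u => p u * A u y)
      (fun u _ => mul_nonneg (hp0 u) (hA u y)) (Finset.mem_univ u))
  have hqZp : ∀ u y, 0 < p u → 0 < B u y → 0 < qZ y := fun u y h1 h2 => by
    rw [← hqZ]
    exact (mul_pos h1 h2).trans_le (Finset.single_le_sum (f := fun u => p u * B u y)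
      (fun u _ => mul_nonneg (hp0 u) (hB u y)) (Finset.mem_univ u))
  have hApos : ∀ u y, p u * A u y ≠ 0 → 0 < p u ∧ 0 < A u y := fun u y h =>
    ⟨lt_of_le_of_ne (hp0 _) fun h' => h (by simp [← h']), lt_of_le_of_ne (hA _ _) fun h' => h (by simp [← h'])⟩
  have hBpos : ∀ u y, p u * B u y ≠ 0 → 0 < p u ∧ 0 < B u y := fun u y h =>
    ⟨lt_of_le_of_ne (hp0 _) fun h' => h (by simp [← h']), lt_of_le_of_ne (hB _ _) fun h' => h (by simp [← h'])⟩
  have hAtot : ∑ u, ∑ y, p u * A u y = 1 := by simp [← Finset.mul_sum, hA1, hp]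
  have hBtot : ∑ u, ∑ y, p u * B u y = 1 := by simp [← Finset.mul_sum, hB1, hp]
  -- exponents
  obtain ⟨s, hs, hs1, hsY⟩ := aux_exists_s2 p hp0 hp A hA hA1
    (fun u y => Real.exp (ρ + t) * qY y / A u y)
    (fun u y h1 h2 => by have := hqYp u y h1 h2; positivity) (by
      have : ∀ u y, p u * A u y * Real.log (Real.exp (ρ + t) * qY y / A u y) =
          (ρ + t) * (p u * A u y) - p u * A u y * Real.log (A u y / qY y) := by
        intro u y
        by_cases h : p u * A u y = 0
        · simp [h]
        · obtain ⟨h1, h2⟩ := hApos u y h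
          have h3 := hqYp u y h1 h2
          rw [Real.log_div (by positivity) h2.ne', Real.log_mul (by positivity) h3.ne', Real.log_exp,
            Real.log_div h2.ne' h3.ne']
          ring
      simp only [this, Finset.sum_sub_distrib, ← Finset.mul_sum]
      rw [show ∑ u, p u * ∑ y, A u y = 1 by simp [hA1, hp]]
      linarith)
  obtain ⟨s', hs', hs1', hsZ⟩ := aux_exists_s2 p hp0 hp B hB hB1
    (fun u y => B u y / (Real.exp t * qZ y))
    (fun u y h1 h2 => by have := hqZp u y h1 h2; positivity) (by
      have : ∀ u y, p u * B u y * Real.log (B u y / (Real.exp t * qZ y)) =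
          p u * B u y * Real.log (B u y / qZ y) - t * (p u * B u y) := by
        intro u y
        by_cases h : p u * B u y = 0
        · simp [h]
        · obtain ⟨h1, h2⟩ := hBpos u y h
          have h3 := hqZp u y h1 h2
          rw [Real.log_div h2.ne' (by positivity), Real.log_mul (by positivity) h3.ne', Real.log_exp,
            Real.log_div h2.ne' h3.ne']
          ring
      simp only [this, Finset.sum_sub_distrib, ← Finset.mul_sum]
      rw [show ∑ u, p u * ∑ y, B u y = 1 by simp [hB1, hp]]
      linarith)
  set aY := ∑ u, ∑ y, p u * A u y * (Real.exp (ρ + t) * qY y / A u y) ^ s with haY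
  set aZ := ∑ u, ∑ y, p u * B u y * (B u y / (Real.exp t * qZ y)) ^ s' with haZ
  have haY0 : 0 ≤ aY := Finset.sum_nonneg fun u _ => Finset.sum_nonneg fun y _ =>
    mul_nonneg (mul_nonneg (hp0 u) (hA u y)) (Real.rpow_nonneg (div_nonneg (mul_nonneg (Real.exp_pos _).le (hqY0 y)) (hA u y)) _)
  have haZ0 : 0 ≤ aZ := Finset.sum_nonneg fun u _ => Finset.sum_nonneg fun y _ =>
    mul_nonneg (mul_nonneg (hp0 u) (hB u y)) (Real.rpow_nonneg (div_nonneg (hB u y) (mul_nonneg (Real.exp_pos _).le (hqZ0 y))) _)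
  obtain ⟨n, hn, hn0⟩ : ∃ n : ℕ, 4 * aY ^ n + (1 / s') * aZ ^ n < ξ ∧ 0 < n := by
    have h1 := (tendsto_pow_atTop_nhds_zero_of_lt_one haY0 hsY).const_mul 4
    have h2 := (tendsto_pow_atTop_nhds_zero_of_lt_one haZ0 hsZ).const_mul (1 / s')
    have h3 := h1.add h2
    simp only [mul_zero, add_zero] at h3
    exact ((h3.eventually_lt_const hξ).and (Filter.eventually_gt_atTop 0)).exists
  set L := ⌈(2 : ℝ) ^ ((n : ℝ) * R)⌉₊ with hL
  have h2e : (2 : ℝ) ^ ((n : ℝ) * R) = Real.exp (n * ρ) := by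
    rw [Real.rpow_def_of_pos (by norm_num), hρ]; congr 1; ring
  have hceil : ∀ a : ℝ, 0 ≤ a → 0 < ⌈Real.exp a⌉₊ ∧ Real.exp a ≤ (⌈Real.exp a⌉₊ : ℝ) ∧
      (⌈Real.exp a⌉₊ : ℝ) ≤ 2 * Real.exp a := by
    intro a ha
    have h1 : 1 ≤ Real.exp a := Real.one_le_exp ha
    refine ⟨Nat.ceil_pos.2 (Real.exp_pos a), Nat.le_ceil _, ?_⟩
    have := Nat.ceil_lt_add_one (Real.exp_pos a).le
    linarith
  obtain ⟨hL0, hL1, hL2⟩ : 0 < L ∧ Real.exp (n * ρ) ≤ (L : ℝ) ∧ (L : ℝ) ≤ 2 * Real.exp (n * ρ) := by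
    rw [hL, h2e]; exact hceil _ (mul_nonneg (Nat.cast_nonneg n) hρ0)
  obtain ⟨K, hK0, hK1, hK2⟩ : ∃ K : ℕ, 0 < K ∧ Real.exp (n * t) ≤ (K : ℝ) ∧ (K : ℝ) ≤ 2 * Real.exp (n * t) :=
    ⟨_, hceil _ (mul_nonneg (Nat.cast_nonneg n) (by linarith))⟩
  clear_value L
  have : Nonempty (Fin L) := ⟨⟨0, hL0⟩⟩
  have : Nonempty (Fin K) := ⟨⟨0, hK0⟩⟩
  have hLp : (0:ℝ) < L := by exact_mod_cast hL0
  have hKp : (0:ℝ) < K := by exact_mod_cast hK0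
  -- n-letter objects
  set pn : (Fin n → V) → ℝ := fun u => ∏ i, p (u i) with hpn
  set An : (Fin n → V) → (Fin n → Y) → ℝ := fun u y => ∏ i, A (u i) (y i) with hAn
  set Bn : (Fin n → V) → (Fin n → Z) → ℝ := fun u y => ∏ i, B (u i) (y i) with hBn
  have hpn0 : ∀ u, 0 ≤ pn u := fun u => Finset.prod_nonneg fun i _ => hp0 _
  have hpn1 : ∑ u, pn u = 1 := by
    rw [hpn, aux_sum_prod1 (fun _ v => p v)]; simp [hp]
  have hAn0 : ∀ u y, 0 ≤ An u y := fun u y => Finset.prod_nonneg fun i _ => hA _ _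
  have hBn0 : ∀ u y, 0 ≤ Bn u y := fun u y => Finset.prod_nonneg fun i _ => hB _ _
  have hAn1 : ∀ u, ∑ y, An u y = 1 := fun u => by
    rw [hAn, aux_sum_prod1 (fun i y => A (u i) y)]; simp [hA1]
  have hBn1 : ∀ u, ∑ y, Bn u y = 1 := fun u => by
    rw [hBn, aux_sum_prod1 (fun i y => B (u i) y)]; simp [hB1]
  have hqYn : ∀ y : Fin n → Y, ∑ u, pn u * An u y = ∏ i, qY (y i) := fun y => by
    simp only [hpn, hAn, ← Finset.prod_mul_distrib]
    rw [aux_sum_prod1 (fun i v => p v * A v (y i))]; simp [hqY]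
  have hqZn : ∀ y : Fin n → Z, ∑ u, pn u * Bn u y = ∏ i, qZ (y i) := fun y => by
    simp only [hpn, hBn, ← Finset.prod_mul_distrib]
    rw [aux_sum_prod1 (fun i v => p v * B v (y i))]; simp [hqZ]
  have hdex : ∀ (c : Fin L × Fin K → Fin n → V) (y : Fin n → Y), ∃ m' : Fin L, ∀ m,
      ∑ w, An (c (m, w)) y ≤ ∑ w, An (c (m', w)) y := fun c y => by
    obtain ⟨m', _, h⟩ := Finset.exists_max_image (univ : Finset (Fin L)) (fun m => ∑ w, An (c (m, w)) y)
      Finset.univ_nonempty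
    exact ⟨m', fun m => h m (Finset.mem_univ m)⟩
  choose d hd using hdex
  have hcor := aux_correct pn hpn0 hpn1 An hAn0 hAn1 _ hqYn d hd hs hs1
  have hres := fun m : Fin L => aux_resolv (ι := Fin L × Fin K) pn hpn0 hpn1 Bn hBn0 _ hqZn
    ((univ : Finset (Fin K)).map ⟨fun w => (m, w), fun a b h => by simpa using h⟩)
    (by simp) hs' hs1'
  simp only [Finset.card_map, Finset.card_univ, Fintype.card_fin, Finset.sum_map] at hres
  rw [Fintype.card_prod, Fintype.card_fin, Fintype.card_fin, Nat.cast_mul] at hcor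
  have hbY : ∑ u, ∑ y, pn u * An u y * ((L : ℝ) * K * (∏ i, qY (y i)) / An u y) ^ s ≤ 4 * aY ^ n := by
    have : aY ^ n = ∏ i : Fin n, ∑ u, ∑ y, p u * A u y * (Real.exp (ρ + t) * qY y / A u y) ^ s := by
      simp [haY]
    rw [this, ← aux_sum_prod, Finset.mul_sum]
    refine Finset.sum_le_sum fun u _ => ?_
    rw [Finset.mul_sum]
    refine Finset.sum_le_sum fun y _ => ?_
    simp only [Finset.prod_mul_distrib]
    rw [mul_left_comm]
    refine mul_le_mul_of_nonneg_left ?_ (mul_nonneg (hpn0 u) (hAn0 u y))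
    rw [Real.finsetProd_rpow _ _ (fun i _ => div_nonneg (mul_nonneg (Real.exp_pos _).le (hqY0 _)) (hA _ _))]
    have h4 : (4:ℝ) ^ s ≤ 4 := by
      simpa using Real.rpow_le_rpow_of_exponent_le (x := 4) (by norm_num) hs1
    have hPQ : 0 ≤ (∏ i, qY (y i)) / An u y := div_nonneg (Finset.prod_nonneg fun i _ => hqY0 _) (hAn0 u y)
    have hpe : ∏ i, (Real.exp (ρ + t) * qY (y i) / A (u i) (y i)) =
       Real.exp (n * ρ) * Real.exp (n * t) * ((∏ i, qY (y i)) / An u y) := by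
      rw [Finset.prod_div_distrib, Finset.prod_mul_distrib, Finset.prod_const, Finset.card_univ, Fintype.card_fin,
        ← Real.exp_nat_mul, mul_add, Real.exp_add, mul_div_assoc]
    rw [hpe, mul_div_assoc]
    calc _ ≤ (4 * (Real.exp (n * ρ) * Real.exp (n * t) * ((∏ i, qY (y i)) / An u y))) ^ s := by
          refine Real.rpow_le_rpow (by positivity) ?_ hs.le
          rw [← mul_assoc]
          refine mul_le_mul_of_nonneg_right ?_ hPQ
          calc (L:ℝ) * K ≤ (2 * Real.exp (n * ρ)) * (2 * Real.exp (n * t)) := by gcongr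
            _ = _ := by ring
      _ = (4:ℝ) ^ s * (Real.exp (n * ρ) * Real.exp (n * t) * ((∏ i, qY (y i)) / An u y)) ^ s :=
          Real.mul_rpow (by norm_num) (by positivity)
      _ ≤ _ := by gcongr
  have hbZ : ∑ u, ∑ y, pn u * Bn u y * (Bn u y / ((K : ℝ) * ∏ i, qZ (y i))) ^ s' ≤ aZ ^ n := by
    have : aZ ^ n = ∏ i : Fin n, ∑ u, ∑ y, p u * B u y * (B u y / (Real.exp t * qZ y)) ^ s' := by
      simp [haZ]
    rw [this, ← aux_sum_prod]
    refine Finset.sum_le_sum fun u _ => Finset.sum_le_sum fun y _ => ?_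
    simp only [Finset.prod_mul_distrib]
    refine mul_le_mul_of_nonneg_left ?_ (mul_nonneg (hpn0 u) (hBn0 u y))
    rw [Real.finsetProd_rpow _ _ (fun i _ => div_nonneg (hB _ _) (mul_nonneg (Real.exp_pos _).le (hqZ0 _)))]
    have hQ0 : 0 ≤ ∏ i, qZ (y i) := Finset.prod_nonneg fun i _ => hqZ0 _
    refine Real.rpow_le_rpow (div_nonneg (hBn0 u y) (by positivity)) ?_ hs'.le
    rw [Finset.prod_div_distrib, Finset.prod_mul_distrib, Finset.prod_const, Finset.card_univ, Fintype.card_fin,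
        ← Real.exp_nat_mul]
    rcases hQ0.eq_or_lt with h | h
    · simp [← h]
    · exact div_le_div_of_nonneg_left (hBn0 u y) (by positivity) (by gcongr)
  set Ferr : (Fin L × Fin K → Fin n → V) → ℝ := fun c => 
    1 - (1 / ((L : ℝ) * (K : ℝ))) * ∑ y, ∑ w, An (c (d c y, w)) y with hFerr
  set Fsec : (Fin L × Fin K → Fin n → V) → ℝ := fun c => 
    (1 / (L:ℝ)) * ∑ m, ∑ z : Fin n → Z, ((∑ w, Bn (c (m, w)) z) / K) *
        Real.log (((∑ w, Bn (c (m, w)) z) / K) / ∏ i, qZ (z i)) with hFsec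
  have hE : EE pn (fun c => Ferr c + Fsec c) < ξ := by
    rw [EE_add]
    refine lt_of_le_of_lt (add_le_add ?_ ?_) hn
    · rw [hFerr, EE_sub, EE_const pn hpn1]
      linarith
    · rw [hFsec, EE_mul, EE_sum]
      calc _ ≤ (1 / (L:ℝ)) * ∑ m : Fin L, (1 / s') * aZ ^ n := by
            refine mul_le_mul_of_nonneg_left (Finset.sum_le_sum fun m _ => ?_) (by positivity)
            refine (hres m).trans ?_
            exact mul_le_mul_of_nonneg_left hbZ (by positivity)
        _ = _ := by
            rw [Finset.sum_const, Finset.card_univ, Fintype.card_fin, nsmul_eq_mul]; field_simp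
  obtain ⟨c, hc⟩ := EE_exists pn hpn0 hpn1 _ hE
  have hF1 : 0 ≤ Ferr c := by
    have h1 : ∑ y, ∑ w, An (c (d c y, w)) y ≤ ∑ y, ∑ m, ∑ w, An (c (m, w)) y :=
      Finset.sum_le_sum fun y _ => Finset.single_le_sum (f := fun m => ∑ w, An (c (m, w)) y)
        (fun m _ => Finset.sum_nonneg fun w _ => hAn0 _ _) (Finset.mem_univ _)
    have h2 : ∑ y, ∑ m, ∑ w, An (c (m, w)) y = L * K := by
      rw [Finset.sum_comm]
      have : ∀ m : Fin L, ∑ y, ∑ w : Fin K, An (c (m, w)) y = K := fun m => by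
        rw [Finset.sum_comm]; simp [hAn1]
      simp [this]
    rw [h2] at h1
    have h3 : (1 / ((L:ℝ) * K)) * ∑ y, ∑ w, An (c (d c y, w)) y ≤ 1 := by
      rw [one_div, inv_mul_le_iff₀ (by positivity)]; linarith
    show 0 ≤ 1 - _
    linarith
  have hF2 : 0 ≤ Fsec c := by
    refine mul_nonneg (by positivity) (Finset.sum_nonneg fun m _ => ?_)
    refine aux_gibbs (fun z : Fin n → Z => (∑ w, Bn (c (m, w)) z) / K) (fun z => ∏ i, qZ (z i))
      (fun z => div_nonneg (Finset.sum_nonneg fun w _ => hBn0 _ _) hKp.le)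
      (fun z => Finset.prod_nonneg fun i _ => hqZ0 _) ?_ ?_ ?_
    · rw [← Finset.sum_div, Finset.sum_comm]; simp [hBn1, hKp.ne']
    · have : ∑ z, qZ z = 1 := by
        simp only [← hqZ]; rw [Finset.sum_comm]; exact hBtot
      rw [aux_sum_prod1 (fun _ z => qZ z)]; simp [this]
    · intro z hz
      obtain ⟨i, _, hi⟩ := Finset.prod_eq_zero_iff.1 hz
      have : ∀ w, Bn (c (m, w)) z = 0 := fun w =>
        Finset.prod_eq_zero (Finset.mem_univ i) (hBq _ _ hi)
      simp [this]
  refine ⟨n, K, hn0, hK0, ?_⟩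
  rw [← hL]
  exact ⟨c, d c, lt_of_le_of_lt (by linarith) hc, lt_of_le_of_lt (by linarith) hc⟩

theorem aux_emp {α : Type*} [Fintype α] (e : α → ℝ) (he0 : ∀ a, 0 ≤ e a) (he1 : ∑ a, e a = 1) :
    ∃ f : (N : ℕ) → Fin N → α, (∀ N w, 0 < e (f N w)) ∧ ∀ g : α → ℝ,
      Filter.Tendsto (fun N : ℕ => (∑ w, g (f N w)) / (N : ℝ)) Filter.atTop (nhds (∑ a, e a * g a)) := by
  classical
  obtain ⟨a0, ha0⟩ : ∃ a0, 0 < e a0 := by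
    by_contra! h
    have : ∑ a, e a ≤ 0 := Finset.sum_nonpos fun a _ => h a
    linarith
  set cc : ℕ → α → ℕ := fun N a => if a = a0 then N - ∑ b ∈ univ.erase a0, ⌊e b * N⌋₊ else ⌊e a * N⌋₊ with hcc
  have hsle : ∀ N : ℕ, ∑ b ∈ univ.erase a0, ⌊e b * (N:ℝ)⌋₊ ≤ N := by
    intro N
    have h1 : ((∑ b ∈ univ.erase a0, ⌊e b * (N:ℝ)⌋₊ : ℕ) : ℝ) ≤ N := by
      push_cast
      calc _ ≤ ∑ b ∈ univ.erase a0, e b * (N:ℝ) :=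
            Finset.sum_le_sum fun b _ => Nat.floor_le (mul_nonneg (he0 b) (Nat.cast_nonneg N))
        _ ≤ ∑ b, e b * (N:ℝ) := Finset.sum_le_sum_of_subset_of_nonneg (Finset.erase_subset _ _)
            fun b _ _ => mul_nonneg (he0 b) (Nat.cast_nonneg N)
        _ = N := by rw [← Finset.sum_mul, he1, one_mul]
    exact_mod_cast h1
  have hsum : ∀ N, ∑ a, cc N a = N := by
    intro N
    rw [← Finset.add_sum_erase univ _ (Finset.mem_univ a0)]
    have : ∑ a ∈ univ.erase a0, cc N a = ∑ b ∈ univ.erase a0, ⌊e b * (N:ℝ)⌋₊ :=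
      Finset.sum_congr rfl fun b hb => by simp [hcc, Finset.ne_of_mem_erase hb]
    rw [this]
    simp only [hcc, if_true]
    exact Nat.sub_add_cancel (hsle N)
  have heq : ∀ N, Nonempty (Fin N ≃ Σ a, Fin (cc N a)) := fun N =>
    ⟨Fintype.equivOfCardEq (by simp [hsum])⟩
  have φ : ∀ N, Fin N ≃ Σ a, Fin (cc N a) := fun N => Classical.choice (heq N)
  refine ⟨fun N w => (φ N w).1, ?_, ?_⟩
  · intro N w
    have h1 : 0 < cc N (φ N w).1 := Fin.pos (φ N w).2
    by_cases h : (φ N w).1 = a0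
    · simp only [h]; exact ha0
    · simp only [hcc, if_neg h] at h1
      have h2 := Nat.floor_pos.1 h1
      refine lt_of_le_of_ne (he0 _) fun h3 => ?_
      rw [← h3] at h2; norm_num at h2
  · intro g
    have e1 : ∀ N : ℕ, (∑ w, g (φ N w).1) / (N:ℝ) = ∑ a, ((cc N a : ℝ) / N) * g a := by
      intro N
      rw [Equiv.sum_comp (φ N) (fun x => g x.1), Fintype.sum_sigma, Finset.sum_div]
      refine Finset.sum_congr rfl fun a _ => ?_
      simp; ring
    simp only [e1]
    refine tendsto_finsetSum _ fun a _ => ?_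
    refine Filter.Tendsto.mul_const _ ?_
    have hfl : ∀ b, Filter.Tendsto (fun N : ℕ => ((⌊e b * (N:ℝ)⌋₊ : ℝ) / N)) Filter.atTop (nhds (e b)) := fun b =>
      (tendsto_nat_floor_mul_div_atTop (he0 b)).comp tendsto_natCast_atTop_atTop
    by_cases h : a = a0
    · subst h
      have h2 : Filter.Tendsto (fun N : ℕ => 1 - ∑ b ∈ univ.erase a, ((⌊e b * (N:ℝ)⌋₊ : ℝ) / N)) Filter.atTop
          (nhds (1 - ∑ b ∈ univ.erase a, e b)) :=
        tendsto_const_nhds.sub (tendsto_finsetSum _ fun b _ => hfl b)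
      have h3 : 1 - ∑ b ∈ univ.erase a, e b = e a := by
        rw [← he1, ← Finset.add_sum_erase univ _ (Finset.mem_univ a)]; ring
      rw [h3] at h2
      refine h2.congr' ?_
      filter_upwards [Filter.eventually_gt_atTop 0] with N hN
      have hN' : (N:ℝ) ≠ 0 := by exact_mod_cast hN.ne'
      simp only [hcc, if_true]
      rw [Nat.cast_sub (hsle N), sub_div, div_self hN', ← Finset.sum_div]
      push_cast; rfl
    · simp only [hcc, if_neg h]
      exact hfl a

theorem distOf_pair_fst {Ω S T : Type*} [Fintype Ω] [Fintype T] [DecidableEq S] [DecidableEq T]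
    (p : Ω → ℝ) (X : Ω → S) (Y : Ω → T) (s : S) :
    distOf p X s = ∑ t, distOf p (fun ω => (X ω, Y ω)) (s, t) := by
  unfold distOf
  rw [Finset.sum_comm]
  refine Finset.sum_congr rfl fun ω _ => ?_
  simp [Prod.mk.injEq, ite_and]

theorem distOf_pair_snd {Ω S T : Type*} [Fintype Ω] [Fintype S] [DecidableEq S] [DecidableEq T]
    (p : Ω → ℝ) (X : Ω → S) (Y : Ω → T) (t : T) :
    distOf p Y t = ∑ s, distOf p (fun ω => (X ω, Y ω)) (s, t) := by
  unfold distOf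
  rw [Finset.sum_comm]
  refine Finset.sum_congr rfl fun ω _ => ?_
  simp [Prod.mk.injEq, ite_and]

theorem KL_eq {α : Type*} [Fintype α] (P Q : α → ℝ) :
    KL P Q = (∑ x, P x * Real.log (P x / Q x)) / Real.log 2 := by
  unfold KL Real.logb
  rw [Finset.sum_div]
  exact Finset.sum_congr rfl fun x _ => by ring

theorem aux_chain {M Z : Type*} [Fintype M] [Fintype Z] (P : M × Z → ℝ) (hP0 : ∀ x, 0 ≤ P x)
    (hP1 : ∑ x, P x = 1) (PM : M → ℝ) (PZ : Z → ℝ) (hPM : ∀ m, PM m = ∑ z, P (m, z))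
    (hPZ : ∀ z, PZ z = ∑ m, P (m, z)) (q : Z → ℝ) (hq0 : ∀ z, 0 ≤ q z) (hq1 : ∑ z, q z = 1)
    (hs : ∀ m z, q z = 0 → P (m, z) = 0) :
    KL P (fun x => PM x.1 * PZ x.2) ≤ KL P (fun x => PM x.1 * q x.2) ∧
    KL PZ q ≤ KL P (fun x => PM x.1 * q x.2) := by
  have hlog2 : 0 < Real.log 2 := Real.log_pos (by norm_num)
  have hPM0 : ∀ m, 0 ≤ PM m := fun m => by rw [hPM]; exact Finset.sum_nonneg fun z _ => hP0 _
  have hPZ0 : ∀ m, 0 ≤ PZ m := fun m => by rw [hPZ]; exact Finset.sum_nonneg fun z _ => hP0 _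
  have hPleM : ∀ m z, P (m, z) ≤ PM m := fun m z => by
    rw [hPM]; exact Finset.single_le_sum (f := fun z => P (m, z)) (fun z _ => hP0 _) (Finset.mem_univ z)
  have hPleZ : ∀ m z, P (m, z) ≤ PZ z := fun m z => by
    rw [hPZ]; exact Finset.single_le_sum (f := fun m => P (m, z)) (fun m _ => hP0 _) (Finset.mem_univ m)
  have hPM1 : ∑ m, PM m = 1 := by simp only [hPM]; rw [← Fintype.sum_prod_type]; exact hP1
  have hPZ1 : ∑ m, PZ m = 1 := by simp only [hPZ]; rw [← Fintype.sum_prod_type_right]; exact hP1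
  have key : KL P (fun x => PM x.1 * q x.2) = KL P (fun x => PM x.1 * PZ x.2) + KL PZ q := by
    rw [KL_eq, KL_eq, KL_eq, ← add_div]
    congr 1
    have : ∑ z, PZ z * Real.log (PZ z / q z) = ∑ x : M × Z, P x * Real.log (PZ x.2 / q x.2) := by
      rw [Fintype.sum_prod_type_right]
      refine Finset.sum_congr rfl fun z _ => ?_
      simp only
      rw [← Finset.sum_mul, ← hPZ]
    rw [this, ← Finset.sum_add_distrib]
    refine Finset.sum_congr rfl fun ⟨m, z⟩ _ => ?_
    rcases (hP0 (m, z)).eq_or_lt with h | h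
    · simp [← h]
    · have h1 := h.trans_le (hPleM m z)
      have h2 := h.trans_le (hPleZ m z)
      have h3 : 0 < q z := lt_of_le_of_ne (hq0 z) fun h' => h.ne' (hs m z h'.symm)
      simp only
      rw [Real.log_div h.ne' (by positivity), Real.log_div h.ne' (by positivity), Real.log_div h2.ne' h3.ne',
        Real.log_mul h1.ne' h3.ne', Real.log_mul h1.ne' h2.ne']
      ring
  have g1 : 0 ≤ KL P (fun x => PM x.1 * PZ x.2) := by
    rw [KL_eq]
    refine div_nonneg (aux_gibbs _ _ hP0 (fun x => mul_nonneg (hPM0 _) (hPZ0 _)) hP1 ?_ ?_) hlog2.le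
    · rw [Fintype.sum_prod_type]; simp [← Finset.mul_sum, hPM1, hPZ1]
    · rintro ⟨m, z⟩ h
      rcases mul_eq_zero.1 h with h | h
      · exact le_antisymm (h ▸ hPleM m z) (hP0 _)
      · exact le_antisymm (h ▸ hPleZ m z) (hP0 _)
  have g2 : 0 ≤ KL PZ q := by
    rw [KL_eq]
    refine div_nonneg (aux_gibbs _ _ hPZ0 hq0 hPZ1 hq1.le ?_) hlog2.le
    intro z h
    rw [hPZ]; exact Finset.sum_eq_zero fun m _ => hs m z h
  constructor <;> linarith

theorem aux_cont_mul_log (r : ℝ) : Continuous (fun t : ℝ => t * Real.log (t / r)) := by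
  by_cases h : r = 0
  · subst h; simpa using continuous_const
  · have : (fun t : ℝ => t * Real.log (t / r)) = fun t => r * ((fun u => u * Real.log u) (t / r)) := by
      funext t; field_simp
    rw [this]
    exact continuous_const.mul (Real.continuous_mul_log.comp (continuous_id.div_const r))

theorem aux_mi {V Y : Type*} [Fintype V] [Fintype Y] {Ω : Type*} [Fintype Ω]
    [DecidableEq V] [DecidableEq Y] (J : Ω → ℝ) (X : Ω → V) (X' : Ω → Y)
    (p : V → ℝ) (A : V → Y → ℝ) (hA1 : ∀ v, ∑ y, A v y = 1)
    (qY : Y → ℝ) (hqY : ∀ y, ∑ v, p v * A v y = qY y)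
    (hJ : ∀ v y, distOf J (fun ω => (X ω, X' ω)) (v, y) = p v * A v y) :
    miRV J X X' = (∑ v, ∑ y, p v * A v y * Real.log (A v y / qY y)) / Real.log 2 := by
  unfold miRV
  rw [KL_eq, Fintype.sum_prod_type]
  congr 1
  refine Finset.sum_congr rfl fun v _ => Finset.sum_congr rfl fun y _ => ?_
  simp only
  rw [hJ, distOf_pair_fst J X X', distOf_pair_snd J X X']
  simp only [hJ, hqY, ← Finset.mul_sum, hA1, mul_one]
  by_cases h : p v = 0
  · simp [h]
  · rw [mul_div_mul_left _ _ h]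

theorem wt_pair {Xc Yc Zc : Type*} [Fintype Xc] [Fintype Yc] [Fintype Zc] [DecidableEq Zc]
    (Q : Xc → Yc × Zc → ℝ) (n L N : ℕ) (f : Fin L × Fin N → Fin n → Xc) (m : Fin L) (z : Fin n → Zc) :
    distOf (wtJoint Q n L N f) (fun ω => (ω.1, ω.2.2.2)) (m, z) =
      (1 / (L : ℝ)) * ((∑ w, ∏ i, ∑ y, Q (f (m, w) i) (y, z i)) / N) := by
  unfold distOf wtJoint
  simp only [Fintype.sum_prod_type, Prod.mk.injEq]
  rw [Finset.sum_eq_single m]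
  · simp only [true_and, Finset.sum_ite_eq', Finset.mem_univ, if_true, ← Finset.mul_sum]
    have : ∀ w, ∑ y : Fin n → Yc, ∏ i, Q (f (m, w) i) (y i, z i) = ∏ i, ∑ y, Q (f (m, w) i) (y, z i) :=
      fun w => aux_sum_prod1 (fun i y => Q (f (m, w) i) (y, z i))
    simp only [this]
    rw [one_div, one_div, mul_inv]; ring
  · intro m' _ h
    simp [h]
  · simp

theorem wt_perr {Xc Yc Zc : Type*} [Fintype Xc] [Fintype Yc] [Fintype Zc]
    (Q : Xc → Yc × Zc → ℝ) (n L N : ℕ) (f : Fin L × Fin N → Fin n → Xc) (d : (Fin n → Yc) → Fin L) :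
    wtPerr Q n L N f d =
      (1 / (L : ℝ)) * ∑ m, ((∑ w, ∑ y : Fin n → Yc, if d y = m then 0 else
        ∏ i, ∑ z, Q (f (m, w) i) (y i, z)) / N) := by
  unfold wtPerr wtJoint
  simp only [Fintype.sum_prod_type]
  rw [Finset.mul_sum]
  refine Finset.sum_congr rfl fun m _ => ?_
  rw [div_eq_inv_mul (_ : ℝ) (N : ℝ), ← mul_assoc (1 / (L : ℝ)) (N : ℝ)⁻¹, Finset.mul_sum]
  refine Finset.sum_congr rfl fun w _ => ?_
  rw [Finset.mul_sum]
  refine Finset.sum_congr rfl fun y _ => ?_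
  by_cases h : d y = m
  · simp [h]
  · simp only [h, if_false, ← Finset.mul_sum]
    rw [aux_sum_prod1 (fun i z => Q (f (m, w) i) (y i, z)), one_div, one_div, mul_inv]

/-- Theorem 1, achievability direction.  Fix a memoryless wire-tap channel
`Q_{YZ|X}`, a joint distribution `Q_{VX}` on a finite auxiliary alphabet `𝒱` times `𝒳`
(Markov chain `V−X−(Y,Z)` holds by construction of the single-letter joint), and let `QZ`
be the induced per-letter eavesdropper output distribution.  Every rate
`0 ≤ R < I(V;Y) − I(V;Z)` is achievable: for all `ξ₁, ξ₂ > 0` there are `n`, `L₁`, an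
encoder `f` and decoder `d` with `Pr[d(Yⁿ) ≠ M] ≤ ξ₁` and
`D(P_{MZⁿ} || P_M × Qⁿ_Z) ≤ ξ₂`; in particular `I(M;Zⁿ) ≤ ξ₂` and
`D(P_{Zⁿ} || Qⁿ_Z) ≤ ξ₂` (confusion and stealth). -/
theorem stmt13 {Vc Xc Yc Zc : Type*} [Fintype Vc] [Fintype Xc] [Fintype Yc] [Fintype Zc]
    [DecidableEq Vc] [DecidableEq Yc] [DecidableEq Zc]
    (Q : Xc → Yc × Zc → ℝ) (hQ : ∀ x, IsDist (Q x))
    (QVX : Vc × Xc → ℝ) (hQVX : IsDist QVX)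
    (QZ : Zc → ℝ)
    (hQZ : ∀ z, QZ z = ∑ q : Vc × Xc, QVX q * ∑ y : Yc, Q q.2 (y, z))
    (R : ℝ) (hR0 : 0 ≤ R)
    (hRlt : R < miRV (fun ω : Vc × Xc × Yc × Zc =>
                  QVX (ω.1, ω.2.1) * Q ω.2.1 (ω.2.2.1, ω.2.2.2))
                (fun ω => ω.1) (fun ω => ω.2.2.1)
            - miRV (fun ω : Vc × Xc × Yc × Zc =>
                  QVX (ω.1, ω.2.1) * Q ω.2.1 (ω.2.2.1, ω.2.2.2))
                (fun ω => ω.1) (fun ω => ω.2.2.2)) :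
    ∀ ξ₁ ξ₂ : ℝ, 0 < ξ₁ → 0 < ξ₂ →
      ∃ n L₁ : ℕ, 0 < n ∧ 0 < L₁ ∧
        ∃ (f : Fin (⌈(2 : ℝ) ^ ((n : ℝ) * R)⌉₊) × Fin L₁ → Fin n → Xc)
          (d : (Fin n → Yc) → Fin (⌈(2 : ℝ) ^ ((n : ℝ) * R)⌉₊)),
          wtPerr Q n (⌈(2 : ℝ) ^ ((n : ℝ) * R)⌉₊) L₁ f d ≤ ξ₁ ∧
          wtDsec Q n (⌈(2 : ℝ) ^ ((n : ℝ) * R)⌉₊) L₁ f QZ ≤ ξ₂ ∧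
          miRV (wtJoint Q n (⌈(2 : ℝ) ^ ((n : ℝ) * R)⌉₊) L₁ f)
              (fun ω => ω.1) (fun ω => ω.2.2.2) ≤ ξ₂ ∧
          KL (distOf (wtJoint Q n (⌈(2 : ℝ) ^ ((n : ℝ) * R)⌉₊) L₁ f) (fun ω => ω.2.2.2))
              (fun zn => ∏ i, QZ (zn i)) ≤ ξ₂ := by
  classical
  intro ξ₁ ξ₂ hξ₁ hξ₂
  have hlog2 : 0 < Real.log 2 := Real.log_pos (by norm_num)
  have hQ0 : ∀ x yz, 0 ≤ Q x yz := fun x => (hQ x).1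
  have hQ1 : ∀ x, ∑ y, ∑ z, Q x (y, z) = 1 := fun x => by
    rw [← Fintype.sum_prod_type]; exact (hQ x).2
  have hVX0 := hQVX.1
  -- single-letter distributions
  set p : Vc → ℝ := fun v => ∑ x, QVX (v, x) with hp_def
  set QX : Xc → ℝ := fun x => ∑ v, QVX (v, x) with hQX_def
  set T : Vc → Xc → ℝ := fun v x => if p v = 0 then QX x else QVX (v, x) / p v with hT_def
  set WY : Xc → Yc → ℝ := fun x y => ∑ z, Q x (y, z) with hWY_def
  set WZ : Xc → Zc → ℝ := fun x z => ∑ y, Q x (y, z) with hWZ_def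
  set A : Vc → Yc → ℝ := fun v y => ∑ x, T v x * WY x y with hA_def
  set B : Vc → Zc → ℝ := fun v z => ∑ x, T v x * WZ x z with hB_def
  have hp0 : ∀ v, 0 ≤ p v := fun v => Finset.sum_nonneg fun x _ => hVX0 _
  have hp1 : ∑ v, p v = 1 := by
    rw [hp_def, ← Fintype.sum_prod_type]; exact hQVX.2
  have hQX0 : ∀ v, 0 ≤ QX v := fun v => Finset.sum_nonneg fun x _ => hVX0 _
  have hQX1 : ∑ v, QX v = 1 := by
    rw [hQX_def, ← Fintype.sum_prod_type_right]; exact hQVX.2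
  have hT0 : ∀ v x, 0 ≤ T v x := fun v x => by
    simp only [hT_def]; split_ifs
    · exact hQX0 x
    · exact div_nonneg (hVX0 _) (hp0 v)
  have hT1 : ∀ v, ∑ x, T v x = 1 := fun v => by
    by_cases h : p v = 0
    · simp only [hT_def, if_pos h]; exact hQX1
    · simp only [hT_def, if_neg h]; rw [← Finset.sum_div]; exact div_self h
  have hpT : ∀ v x, p v * T v x = QVX (v, x) := fun v x => by
    by_cases h : p v = 0
    · have := (Finset.sum_eq_zero_iff_of_nonneg (fun x _ => hVX0 (v, x))).1 h x (Finset.mem_univ x)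
      rw [h, this, zero_mul]
    · simp only [hT_def, if_neg h]; exact mul_div_cancel₀ _ h
  have hTX : ∀ v x, QX x = 0 → T v x = 0 := fun v x h => by
    have h1 := (Finset.sum_eq_zero_iff_of_nonneg (fun v _ => hVX0 (v, x))).1 h v (Finset.mem_univ v)
    simp only [hT_def, h, h1, zero_div, ite_self]
  have hWY0 : ∀ x y, 0 ≤ WY x y := fun x y => Finset.sum_nonneg fun z _ => hQ0 _ _
  have hWZ0 : ∀ x y, 0 ≤ WZ x y := fun x y => Finset.sum_nonneg fun z _ => hQ0 _ _
  have hWY1 : ∀ x, ∑ y, WY x y = 1 := hQ1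
  have hWZ1 : ∀ x, ∑ y, WZ x y = 1 := fun x => by
    simp only [hWZ_def]; rw [Finset.sum_comm]; exact hQ1 x
  have hA0 : ∀ v y, 0 ≤ A v y := fun v y => Finset.sum_nonneg fun x _ => mul_nonneg (hT0 _ _) (hWY0 _ _)
  have hB0 : ∀ v y, 0 ≤ B v y := fun v y => Finset.sum_nonneg fun x _ => mul_nonneg (hT0 _ _) (hWZ0 _ _)
  have hA1 : ∀ v, ∑ y, A v y = 1 := fun v => by
    simp only [hA_def]; rw [Finset.sum_comm]; simp [← Finset.mul_sum, hWY1, hT1]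
  have hB1 : ∀ v, ∑ y, B v y = 1 := fun v => by
    simp only [hB_def]; rw [Finset.sum_comm]; simp [← Finset.mul_sum, hWZ1, hT1]
  have hpA : ∀ v y, p v * A v y = ∑ x, QVX (v, x) * WY x y := fun v y => by
    simp only [hA_def, Finset.mul_sum, ← mul_assoc, hpT]
  have hpB : ∀ v y, p v * B v y = ∑ x, QVX (v, x) * WZ x y := fun v y => by
    simp only [hB_def, Finset.mul_sum, ← mul_assoc, hpT]
  have hqZ : ∀ z, ∑ v, p v * B v z = QZ z := fun z => by
    simp only [hpB]; rw [hQZ, Fintype.sum_prod_type]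
  have hQZX : ∀ z, QZ z = ∑ x, QX x * WZ x z := fun z => by
    rw [hQZ, Fintype.sum_prod_type_right]
    refine Finset.sum_congr rfl fun x _ => ?_
    simp only [hQX_def, Finset.sum_mul, hWZ_def]
  have hQZ0 : ∀ z, 0 ≤ QZ z := fun z => by
    rw [hQZX]; exact Finset.sum_nonneg fun x _ => mul_nonneg (hQX0 _) (hWZ0 _ _)
  have hQZ1 : ∑ z, QZ z = 1 := by
    simp only [hQZX]; rw [Finset.sum_comm]; simp [← Finset.mul_sum, hWZ1, hQX1]
  have hsuppZ : ∀ x z, QZ z = 0 → 0 < QX x → WZ x z = 0 := fun x z h hx => by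
    rw [hQZX] at h
    have := (Finset.sum_eq_zero_iff_of_nonneg (fun x _ => mul_nonneg (hQX0 x) (hWZ0 x z))).1 h x (Finset.mem_univ x)
    rcases mul_eq_zero.1 this with h | h
    · exact absurd h hx.ne'
    · exact h
  have hBq : ∀ v z, QZ z = 0 → B v z = 0 := fun v z h => Finset.sum_eq_zero fun x _ => by
    rcases (hQX0 x).eq_or_lt with h1 | h1
    · rw [hTX v x h1.symm, zero_mul]
    · rw [hsuppZ x z h h1, mul_zero]
  have hIZ : 0 ≤ ∑ v, ∑ z, p v * B v z * Real.log (B v z / QZ z) :=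
    Finset.sum_nonneg fun v _ => by
      simp only [mul_assoc]
      rw [← Finset.mul_sum]
      exact mul_nonneg (hp0 v) (aux_gibbs _ _ (hB0 v) hQZ0 (hB1 v) hQZ1.le (hBq v))
  have hmiY := aux_mi (fun ω : Vc × Xc × Yc × Zc => QVX (ω.1, ω.2.1) * Q ω.2.1 (ω.2.2.1, ω.2.2.2))
    (fun ω => ω.1) (fun ω => ω.2.2.1) p A hA1 _ (fun _ => rfl) (fun v y => by
      unfold distOf
      simp only [Fintype.sum_prod_type, Prod.mk.injEq]
      rw [Finset.sum_eq_single v, hpA]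
      · refine Finset.sum_congr rfl fun x _ => ?_
        rw [Finset.sum_eq_single y]
        · simp [← Finset.mul_sum, hWY_def]
        · intro y' _ h; simp [h]
        · simp
      · intro v' _ h; simp [h]
      · simp)
  have hmiZ := aux_mi (fun ω : Vc × Xc × Yc × Zc => QVX (ω.1, ω.2.1) * Q ω.2.1 (ω.2.2.1, ω.2.2.2))
    (fun ω => ω.1) (fun ω => ω.2.2.2) p B hB1 QZ hqZ (fun v z => by
      unfold distOf
      simp only [Fintype.sum_prod_type, Prod.mk.injEq]
      rw [Finset.sum_eq_single v, hpB]
      · refine Finset.sum_congr rfl fun x _ => ?_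
        simp [← Finset.mul_sum, hWZ_def]
      · intro v' _ h; simp [h]
      · simp)
  rw [hmiY, hmiZ, ← sub_div, lt_div_iff₀ hlog2] at hRlt
  obtain ⟨n, K, hn, hK, c, d, herr, hsec⟩ := aux_core p hp0 hp1 A hA0 hA1 B hB0 hB1 _ (fun _ => rfl) QZ hqZ hBq R hR0
    hIZ hRlt (min ξ₁ (ξ₂ * Real.log 2)) (lt_min hξ₁ (mul_pos hξ₂ hlog2))
  refine ⟨n, ?_⟩
  have hL0 : 0 < ⌈(2 : ℝ) ^ ((n : ℝ) * R)⌉₊ := Nat.ceil_pos.2 (by positivity)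
  generalize ⌈(2 : ℝ) ^ ((n : ℝ) * R)⌉₊ = L at c d herr hsec hL0 ⊢
  have hLp : (0:ℝ) < L := by exact_mod_cast hL0
  have hKp : (0:ℝ) < K := by exact_mod_cast hK
  -- stochastic encoder
  set e : Fin L → (Fin n → Xc) → ℝ := fun m x => (∑ w, ∏ i, T (c (m, w) i) (x i)) / K with he_def
  have he0 : ∀ m x, 0 ≤ e m x := fun m x =>
    div_nonneg (Finset.sum_nonneg fun w _ => Finset.prod_nonneg fun i _ => hT0 _ _) hKp.le
  have he1 : ∀ m, ∑ x, e m x = 1 := fun m => by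
    simp only [he_def]
    rw [← Finset.sum_div, Finset.sum_comm]
    have : ∀ w, ∑ x : Fin n → Xc, ∏ i, T (c (m, w) i) (x i) = 1 := fun w => by
      rw [aux_sum_prod1 (fun i x => T (c (m, w) i) x)]; simp [hT1]
    simp [this, hKp.ne']
  have heX : ∀ m x, 0 < e m x → ∀ i, 0 < QX (x i) := fun m x h i => by
    refine lt_of_le_of_ne (hQX0 _) fun h0 => h.ne' ?_
    have : ∀ w, ∏ i, T (c (m, w) i) (x i) = 0 := fun w =>
      Finset.prod_eq_zero (Finset.mem_univ i) (hTX _ _ h0.symm)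
    simp [he_def, this]
  have heY : ∀ m (y : Fin n → Yc), ∑ x, e m x * ∏ i, WY (x i) (y i) = (∑ w, ∏ i, A (c (m, w) i) (y i)) / K := by
    intro m y
    simp only [he_def, div_mul_eq_mul_div, Finset.sum_mul]
    rw [← Finset.sum_div, Finset.sum_comm]
    congr 1
    refine Finset.sum_congr rfl fun w _ => ?_
    simp only [← Finset.prod_mul_distrib]
    rw [aux_sum_prod1 (fun i x => T (c (m, w) i) x * WY x (y i))]
  have heZ : ∀ m (y : Fin n → Zc), ∑ x, e m x * ∏ i, WZ (x i) (y i) = (∑ w, ∏ i, B (c (m, w) i) (y i)) / K := by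
    intro m y
    simp only [he_def, div_mul_eq_mul_div, Finset.sum_mul]
    rw [← Finset.sum_div, Finset.sum_comm]
    congr 1
    refine Finset.sum_congr rfl fun w _ => ?_
    simp only [← Finset.prod_mul_distrib]
    rw [aux_sum_prod1 (fun i x => T (c (m, w) i) x * WZ x (y i))]
  choose F hF1 hF2 using fun m => aux_emp (e m) (he0 m) (he1 m)
  set f : (N : ℕ) → Fin L × Fin N → Fin n → Xc := fun N mw => F mw.1 N mw.2 with hf_def
  -- limits
  have hlimE : Filter.Tendsto (fun N => wtPerr Q n L N (f N) d) Filter.atTop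
      (nhds (1 - (1 / ((L:ℝ) * K)) * ∑ y, ∑ w, ∏ i, A (c (d y, w) i) (y i))) := by
    have h1 : ∀ N, wtPerr Q n L N (f N) d = (1 / (L : ℝ)) * ∑ m, ((∑ w, ∑ y : Fin n → Yc, if d y = m then 0 else
        ∏ i, WY (F m N w i) (y i)) / N) := fun N => wt_perr Q n L N (f N) d
    simp only [h1]
    have h2 : 1 - (1 / ((L:ℝ) * K)) * ∑ y, ∑ w, ∏ i, A (c (d y, w) i) (y i) =
        (1 / (L : ℝ)) * ∑ m, ∑ x, e m x * ∑ y : Fin n → Yc, if d y = m then 0 else ∏ i, WY (x i) (y i) := by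
      have h3 : ∀ m, ∑ x, e m x * ∑ y : Fin n → Yc, (if d y = m then 0 else ∏ i, WY (x i) (y i)) =
          ∑ y : Fin n → Yc, if d y = m then 0 else (∑ w, ∏ i, A (c (m, w) i) (y i)) / K := by
        intro m
        simp only [Finset.mul_sum]
        rw [Finset.sum_comm]
        refine Finset.sum_congr rfl fun y _ => ?_
        by_cases h : d y = m
        · simp [h]
        · simp only [h, if_false]; exact heY m y
      have h4 : ∀ m (y : Fin n → Yc), (if d y = m then 0 else (∑ w, ∏ i, A (c (m, w) i) (y i)) / (K:ℝ)) =
          (∑ w, ∏ i, A (c (m, w) i) (y i)) / K - if d y = m then (∑ w, ∏ i, A (c (m, w) i) (y i)) / (K:ℝ) else 0 := by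
        intro m y; split_ifs <;> simp
      simp only [h3, h4, Finset.sum_sub_distrib]
      rw [Finset.sum_comm (f := fun m y => if d y = m then (∑ w, ∏ i, A (c (m, w) i) (y i)) / (K:ℝ) else 0)]
      simp only [Finset.sum_ite_eq, Finset.mem_univ, if_true]
      have h5 : ∀ m, ∑ y : Fin n → Yc, (∑ w, ∏ i, A (c (m, w) i) (y i)) / (K:ℝ) = 1 := by
        intro m
        rw [← Finset.sum_div, Finset.sum_comm]
        have : ∀ w, ∑ y : Fin n → Yc, ∏ i, A (c (m, w) i) (y i) = 1 := fun w => by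
          rw [aux_sum_prod1 (fun i x => A (c (m, w) i) x)]; simp [hA1]
        simp [this, hKp.ne']
      simp only [h5]
      rw [← Finset.sum_div]
      simp
      field_simp
    rw [h2]
    refine (tendsto_finsetSum _ fun m _ => ?_).const_mul _
    exact hF2 m (fun x => ∑ y : Fin n → Yc, if d y = m then 0 else ∏ i, WY (x i) (y i))
  -- joint distribution of (M, Z)
  have hpair : ∀ N m z, distOf (wtJoint Q n L N (f N)) (fun ω => (ω.1, ω.2.2.2)) (m, z) =
      (1 / (L : ℝ)) * ((∑ w, ∏ i, WZ (F m N w i) (z i)) / N) := fun N m z => wt_pair Q n L N (f N) m z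
  have hWZn1 : ∀ x : Fin n → Xc, ∑ z : Fin n → Zc, ∏ i, WZ (x i) (z i) = 1 := fun x => by
    rw [aux_sum_prod1 (fun i z => WZ (x i) z)]; simp [hWZ1]
  have hmarg : ∀ N, 0 < N → ∀ m, distOf (wtJoint Q n L N (f N)) (fun ω => ω.1) m = 1 / (L : ℝ) := by
    intro N hN m
    have hNp : (N:ℝ) ≠ 0 := by exact_mod_cast hN.ne'
    rw [distOf_pair_fst (wtJoint Q n L N (f N)) (fun ω => ω.1) (fun ω => ω.2.2.2)]
    simp only [hpair]
    rw [← Finset.mul_sum, ← Finset.sum_div, Finset.sum_comm]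
    simp [hWZn1, hNp]
  have hlimS : Filter.Tendsto (fun N => wtDsec Q n L N (f N) QZ) Filter.atTop
      (nhds (((1 / (L:ℝ)) * ∑ m, ∑ z : Fin n → Zc, ((∑ w, ∏ i, B (c (m, w) i) (z i)) / K) *
        Real.log (((∑ w, ∏ i, B (c (m, w) i) (z i)) / K) / ∏ i, QZ (z i))) / Real.log 2)) := by
    have h1 : ∀ᶠ N : ℕ in Filter.atTop, ((1 / (L:ℝ)) * ∑ m, ∑ z : Fin n → Zc, ((∑ w, ∏ i, WZ (F m N w i) (z i)) / N) *
        Real.log (((∑ w, ∏ i, WZ (F m N w i) (z i)) / N) / ∏ i, QZ (z i))) / Real.log 2 = wtDsec Q n L N (f N) QZ := by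
      filter_upwards [Filter.eventually_gt_atTop 0] with N hN
      unfold wtDsec
      rw [KL_eq, Fintype.sum_prod_type, Finset.mul_sum]
      congr 1
      refine Finset.sum_congr rfl fun m _ => ?_
      rw [Finset.mul_sum]
      refine Finset.sum_congr rfl fun z _ => ?_
      simp only
      rw [hpair, hmarg N hN, mul_div_mul_left _ _ (by positivity)]
      ring
    refine Filter.Tendsto.congr' h1 ?_
    refine Filter.Tendsto.div_const (Filter.Tendsto.const_mul _ ?_) _
    refine tendsto_finsetSum _ fun m _ => tendsto_finsetSum _ fun z _ => ?_
    have h2 := hF2 m (fun x => ∏ i, WZ (x i) (z i))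
    rw [heZ] at h2
    exact ((aux_cont_mul_log (∏ i, QZ (z i))).tendsto _).comp h2
  have hE' := hlimE.eventually_lt_const (herr.trans_le (min_le_left _ _))
  have hS' := hlimS.eventually_lt_const (u := ξ₂) (by
    rw [div_lt_iff₀ hlog2]; exact hsec.trans_le (min_le_right _ _))
  obtain ⟨N, ⟨hNE, hNS⟩, hN⟩ := ((hE'.and hS').and (Filter.eventually_gt_atTop 0)).exists
  have hNp : (0:ℝ) < N := by exact_mod_cast hN
  have hch := aux_chain (distOf (wtJoint Q n L N (f N)) (fun ω => (ω.1, ω.2.2.2)))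
    (by
      rintro ⟨m, z⟩
      rw [hpair]
      exact mul_nonneg (by positivity) (div_nonneg (Finset.sum_nonneg fun w _ =>
        Finset.prod_nonneg fun i _ => hWZ0 _ _) hNp.le))
    (by
      rw [Fintype.sum_prod_type]
      simp only [← distOf_pair_fst (wtJoint Q n L N (f N)) (fun ω => ω.1) (fun ω => ω.2.2.2), hmarg N hN]
      simp [hLp.ne'])
    _ _ (distOf_pair_fst (wtJoint Q n L N (f N)) (fun ω => ω.1) (fun ω => ω.2.2.2))
    (distOf_pair_snd (wtJoint Q n L N (f N)) (fun ω => ω.1) (fun ω => ω.2.2.2))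
    (fun z => ∏ i, QZ (z i)) (fun z => Finset.prod_nonneg fun i _ => hQZ0 _)
    (by rw [aux_sum_prod1 (fun _ z => QZ z)]; simp [hQZ1])
    (by
      intro m z hz
      obtain ⟨i, _, hi⟩ := Finset.prod_eq_zero_iff.1 hz
      have : ∀ w, ∏ i, WZ (F m N w i) (z i) = 0 := fun w =>
        Finset.prod_eq_zero (Finset.mem_univ i) (hsuppZ _ _ hi (heX m _ (hF1 m N w) i))
      rw [hpair]; simp [this])
  exact ⟨N, hn, hN, f N, d, hNE.le, hNS.le, hch.1.trans hNS.le, hch.2.trans hNS.le⟩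
end
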